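/- arXiv:math/9501210 — 2 statements merged into one kernel-verified Lean document; each statement's English description precedes it below -/
import Mathlib

section
/- Upper Santaló bound for p-balls: for every p-ball B ⊆ ℝⁿ, the volume product satisfies s(B) = (|B|·|B°|)^(1/n) ≤ s(B_{ℓ₂ⁿ}) = (|B_{ℓ₂ⁿ}|²)^(1/n), i.e., the volume product of B is at most that of the Euclidean ball. -/
open MeasureTheory Set Pointwise ENNReal

noncomputable section

/-- `B` is a `p`-ball in `ℝⁿ`: a compact symmetric `p`-convex set with `0` in its
interior. -/
def IsPBall (n : ℕ) (p : ℝ) (B : Set (Fin n → ℝ)) : Prop :=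
  IsCompact B ∧ B = -B ∧ (0 : Fin n → ℝ) ∈ interior B ∧
    ∀ x ∈ B, ∀ y ∈ B, ∀ l m : ℝ, 0 ≤ l → 0 ≤ m → l ^ p + m ^ p = 1 →
      l • x + m • y ∈ B

/-- The polar set `B° = {x : ⟨x,y⟩ ≤ 1 for all y ∈ B}`. -/
def polarSet (n : ℕ) (B : Set (Fin n → ℝ)) : Set (Fin n → ℝ) :=
  {x | ∀ y ∈ B, ∑ i, x i * y i ≤ 1}

/-- The Euclidean unit ball of `ℝⁿ`. -/
def euclBall (n : ℕ) : Set (Fin n → ℝ) := {x | ∑ i, x i ^ 2 ≤ 1}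

/-- The volume product `s(B) = (|B| · |B°|)^(1/n)`. -/
def sVol (n : ℕ) (B : Set (Fin n → ℝ)) : ℝ :=
  ((volume B).toReal * (volume (polarSet n B)).toReal) ^ ((1 : ℝ) / n)

/-- `M(B,D) = ((|B+D|/|B∩D|) · (|B°+D°|/|B°∩D°|))^(1/n)`. -/
def MVol (n : ℕ) (B D : Set (Fin n → ℝ)) : ℝ :=
  (((volume (B + D)).toReal / (volume (B ∩ D)).toReal) *
    ((volume (polarSet n B + polarSet n D)).toReal /
      (volume (polarSet n B ∩ polarSet n D)).toReal)) ^ ((1 : ℝ) / n)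

/-- `D` is a (centered) ellipsoid: a linear image of the Euclidean unit ball. -/
def IsEllipsoid (n : ℕ) (D : Set (Fin n → ℝ)) : Prop :=
  ∃ u : (Fin n → ℝ) ≃ₗ[ℝ] (Fin n → ℝ), D = u '' euclBall n

/-- The Prékopa–Leindler property (with parameter `1/2`) of a measure `μ` with respect to a
ternary relation `R x y z`, read as "`z` is a mean of `x` and `y`". -/
def PrekopaLeindler {α : Type*} [MeasurableSpace α] (μ : Measure α) (R : α → α → α → Prop) :
    Prop :=
  ∀ f g h : α → ℝ≥0∞, Measurable f → Measurable g → Measurable h →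
    (∀ x y z, R x y z → f x * g y ≤ h z ^ 2) →
    (∫⁻ x, f x ∂μ) * (∫⁻ x, g x ∂μ) ≤ (∫⁻ x, h x ∂μ) ^ 2

namespace PrekopaLeindler

theorem prod {α β : Type*} [MeasurableSpace α] [MeasurableSpace β] {μ : Measure α}
    {ν : Measure β} [SFinite μ] [SFinite ν] {R : α → α → α → Prop} {S : β → β → β → Prop}
    (hR : PrekopaLeindler μ R) (hS : PrekopaLeindler ν S) :
    PrekopaLeindler (μ.prod ν) (fun x y z => R x.1 y.1 z.1 ∧ S x.2 y.2 z.2) := by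
  intro f g h hf hg hh H
  rw [lintegral_prod _ hf.aemeasurable, lintegral_prod _ hg.aemeasurable,
    lintegral_prod _ hh.aemeasurable]
  refine hR _ _ _ hf.lintegral_prod_right' hg.lintegral_prod_right' hh.lintegral_prod_right' ?_
  intro x y z hxyz
  exact hS _ _ _ (hf.comp measurable_prodMk_left) (hg.comp measurable_prodMk_left)
    (hh.comp measurable_prodMk_left) fun u v w huvw => H (x, u) (y, v) (z, w) ⟨hxyz, huvw⟩

theorem of_measurePreserving {α β : Type*} [MeasurableSpace α] [MeasurableSpace β]
    {μ : Measure α} {ν : Measure β} {R : α → α → α → Prop} {S : β → β → β → Prop}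
    (hR : PrekopaLeindler μ R) (e : α ≃ᵐ β) (he : MeasurePreserving e μ ν)
    (hRS : ∀ x y z, R x y z → S (e x) (e y) (e z)) : PrekopaLeindler ν S := by
  intro f g h hf hg hh H
  rw [← he.lintegral_comp hf, ← he.lintegral_comp hg, ← he.lintegral_comp hh]
  exact hR _ _ _ (hf.comp e.measurable) (hg.comp e.measurable) (hh.comp e.measurable)
    fun x y z hxyz => H _ _ _ (hRS x y z hxyz)

theorem pi_fin {R : ℝ → ℝ → ℝ → Prop} (hR : PrekopaLeindler volume R) (n : ℕ) :
    PrekopaLeindler (volume : Measure (Fin n → ℝ)) (fun x y z => ∀ i, R (x i) (y i) (z i)) := by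
  induction n with
  | zero =>
    intro f g h _ _ _ H
    have hv : (volume : Measure (Fin 0 → ℝ)) = Measure.dirac default := by
      rw [volume_pi]; exact Measure.pi_of_empty _ _
    rw [hv]
    simpa using H default default default (fun i => i.elim0)
  | succ n ih =>
    refine (hR.prod ih).of_measurePreserving (MeasurableEquiv.piFinSuccAbove (fun _ => ℝ) 0).symm
      ((volume_preserving_piFinSuccAbove (fun _ => ℝ) 0).symm _) ?_
    rintro x y z ⟨h0, h1⟩ i
    refine Fin.cases ?_ (fun j => ?_) i
    · exact h0
    · exact h1 j

theorem pi {ι : Type*} [Fintype ι] {R : ℝ → ℝ → ℝ → Prop} (hR : PrekopaLeindler volume R) :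
    PrekopaLeindler (volume : Measure (ι → ℝ)) (fun x y z => ∀ i, R (x i) (y i) (z i)) := by
  have e := (Fintype.equivFin ι).symm
  refine (pi_fin hR (Fintype.card ι)).of_measurePreserving
    (MeasurableEquiv.piCongrLeft (fun _ => ℝ) e)
    (volume_measurePreserving_piCongrLeft (fun _ => ℝ) e) ?_
  intro x y z h i
  obtain ⟨j, rfl⟩ := e.surjective i
  simpa only [MeasurableEquiv.piCongrLeft_apply_apply] using h j

theorem measure_mul_le {α : Type*} [MeasurableSpace α] {μ : Measure α}
    {R : α → α → α → Prop} (hR : PrekopaLeindler μ R) {X Y Z : Set α} (hX : MeasurableSet X)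
    (hY : MeasurableSet Y) (hZ : MeasurableSet Z)
    (H : ∀ x ∈ X, ∀ y ∈ Y, ∀ z, R x y z → z ∈ Z) : μ X * μ Y ≤ μ Z ^ 2 := by
  have := hR (X.indicator 1) (Y.indicator 1) (Z.indicator 1) (measurable_one.indicator hX)
    (measurable_one.indicator hY) (measurable_one.indicator hZ) ?_
  · simpa [lintegral_indicator_one, hX, hY, hZ] using this
  · intro x y z hxyz
    by_cases hx : x ∈ X <;> by_cases hy : y ∈ Y <;> simp [hx, hy]
    simp [H x hx y hy z hxyz]

end PrekopaLeindler

/-- One-dimensional Brunn–Minkowski inequality. -/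
theorem Real.volume_add_volume_le {A B C : Set ℝ} (hA : MeasurableSet A) (hB : MeasurableSet B)
    (hA0 : A.Nonempty) (hB0 : B.Nonempty) (H : ∀ x ∈ A, ∀ y ∈ B, (x + y) / 2 ∈ C) :
    volume A + volume B ≤ 2 * volume C := by
  have key : ∀ K ⊆ A, IsCompact K → K.Nonempty → ∀ L ⊆ B, IsCompact L → L.Nonempty →
      volume K + volume L ≤ 2 * volume C := by
    intro K hKA hK hK0 L hLB hL hL0
    obtain ⟨a, haK, ha⟩ := hK.exists_isGreatest hK0
    obtain ⟨b, hbL, hb⟩ := hL.exists_isLeast hL0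
    have hsub : (b +ᵥ K) ∪ (a +ᵥ L) ⊆ (2 : ℝ) • C := by
      rintro _ (⟨x, hx, rfl⟩ | ⟨x, hx, rfl⟩)
      · exact ⟨(x + b) / 2, H x (hKA hx) b (hLB hbL), by simp; ring⟩
      · exact ⟨(a + x) / 2, H a (hKA haK) x (hLB hx), by simp; ring⟩
    have hint : volume ((b +ᵥ K) ∩ (a +ᵥ L)) = 0 := by
      refine measure_mono_null ?_ (measure_singleton (a + b))
      rintro _ ⟨⟨x, hx, rfl⟩, ⟨y, hy, hxy⟩⟩
      have h1 := ha hx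
      have h2 := hb hy
      simp only [vadd_eq_add, mem_singleton_iff] at hxy ⊢
      linarith
    have hmeas : MeasurableSet (a +ᵥ L) := (hL.vadd a).measurableSet
    have hun := measure_union_add_inter (μ := volume) (b +ᵥ K) hmeas
    rw [hint, add_zero, measure_vadd, measure_vadd] at hun
    rw [← hun]
    refine (measure_mono hsub).trans_eq ?_
    rw [Measure.addHaar_smul]
    simp
  have key_compact : ∀ K, (K ⊆ A ∧ IsCompact K) → ∀ L, (L ⊆ B ∧ IsCompact L) →
      volume K + volume L ≤ 2 * volume C := by
    rintro K ⟨hKA, hK⟩ L ⟨hLB, hL⟩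
    obtain ⟨a, ha⟩ := hA0
    obtain ⟨b, hb⟩ := hB0
    refine le_trans ?_ (key (insert a K) (insert_subset ha hKA) (hK.insert a) (insert_nonempty _ _)
      (insert b L) (insert_subset hb hLB) (hL.insert b) (insert_nonempty _ _))
    gcongr <;> exact subset_insert _ _
  rw [hA.measure_eq_iSup_isCompact, hB.measure_eq_iSup_isCompact]
  simp only [iSup_and']
  exact ENNReal.biSup_add_biSup_le' ⟨∅, by simp⟩ ⟨∅, by simp⟩ key_compact

theorem lintegral_eq_lintegral_ofReal_lt {α : Type*} [MeasurableSpace α] (μ : Measure α)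
    {f : α → ℝ≥0∞} (hf : Measurable f) (hf_top : ∀ x, f x ≠ ⊤) :
    ∫⁻ x, f x ∂μ = ∫⁻ t in Ioi (0 : ℝ), μ {x | ENNReal.ofReal t < f x} := by
  have := lintegral_eq_lintegral_meas_lt μ (f := fun x => (f x).toReal)
    (Filter.Eventually.of_forall fun _ => ENNReal.toReal_nonneg) hf.ennreal_toReal.aemeasurable
  simp only [ENNReal.ofReal_toReal (hf_top _)] at this
  rw [this]
  refine setLIntegral_congr_fun measurableSet_Ioi fun t ht => ?_
  simp only [ENNReal.ofReal_lt_iff_lt_toReal (le_of_lt ht) (hf_top _)]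

theorem ENNReal.mul_le_sq_of_add_le_two_mul {a b c : ℝ≥0∞} (h : a + b ≤ 2 * c) :
    a * b ≤ c ^ 2 := by
  rcases eq_or_ne c ⊤ with rfl | hc
  · simp
  have hab : a + b ≠ ⊤ := ne_top_of_le_ne_top (ENNReal.mul_ne_top ENNReal.ofNat_ne_top hc) h
  lift c to NNReal using hc
  lift a to NNReal using (ENNReal.add_ne_top.1 hab).1
  lift b to NNReal using (ENNReal.add_ne_top.1 hab).2
  norm_cast at h ⊢
  have h' : (a : ℝ) + b ≤ 2 * c := by exact_mod_cast h
  have : (a : ℝ) * b ≤ c ^ 2 := by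
    nlinarith [sq_nonneg ((a : ℝ) - b), a.coe_nonneg, b.coe_nonneg, c.coe_nonneg]
  exact_mod_cast this

theorem MeasureTheory.lintegral_eq_iSup_min_natCast {α : Type*} [MeasurableSpace α]
    {μ : Measure α} {f : α → ℝ≥0∞} (hf : Measurable f) :
    ∫⁻ x, f x ∂μ = ⨆ n : ℕ, ∫⁻ x, min (f x) n ∂μ := by
  rw [← lintegral_iSup (fun n => hf.min measurable_const)]
  · refine lintegral_congr fun x => ?_
    rw [← inf_iSup_eq, ENNReal.iSup_natCast, inf_top_eq]
  · intro m n hmn x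
    dsimp only
    gcongr

theorem lintegral_Ioi_eq_lintegral_exp (f : ℝ → ℝ≥0∞) :
    ∫⁻ x in Ioi 0, f x = ∫⁻ u, ENNReal.ofReal (Real.exp u) * f (Real.exp u) := by
  have := lintegral_image_eq_lintegral_abs_deriv_mul (s := univ) MeasurableSet.univ
    (fun x _ => (Real.hasDerivAt_exp x).hasDerivWithinAt) Real.exp_injective.injOn f
  rw [image_univ, Real.range_exp] at this
  simpa [abs_of_pos (Real.exp_pos _)] using this

theorem lintegral_eq_lintegral_exp {f : ℝ → ℝ≥0∞} (hf : Measurable f) :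
    ∫⁻ x, f x = (∫⁻ u, ENNReal.ofReal (Real.exp u) * f (1 * Real.exp u)) +
      ∫⁻ u, ENNReal.ofReal (Real.exp u) * f (-1 * Real.exp u) := by
  have hneg : ∫⁻ x in Iio 0, f x = ∫⁻ x in Ioi 0, f (-x) := by
    have h := (Measure.measurePreserving_neg (volume : Measure ℝ)).setLIntegral_comp_preimage
      (measurableSet_Iio (a := (0 : ℝ))) hf
    rw [← h]
    simp
  rw [← lintegral_add_compl f (measurableSet_Ioi (a := (0 : ℝ))), compl_Ioi,
    ← restrict_Iio_eq_restrict_Iic, hneg, lintegral_Ioi_eq_lintegral_exp,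
    lintegral_Ioi_eq_lintegral_exp fun x => f (-x)]
  simp

namespace PrekopaLeindler

theorem lintegral_add_le_of_iSup_eq_one {f g h : ℝ → ℝ≥0∞} (hf : Measurable f)
    (hg : Measurable g) (hh : Measurable h) (hf1 : ⨆ x, f x = 1) (hg1 : ⨆ x, g x = 1)
    (H : ∀ x y, f x * g y ≤ h ((x + y) / 2) ^ 2) :
    (∫⁻ x, f x) + (∫⁻ x, g x) ≤ 2 * ∫⁻ x, h x := by
  have hf_le : ∀ x, f x ≤ 1 := fun x => hf1 ▸ le_iSup f x
  have hg_le : ∀ x, g x ≤ 1 := fun x => hg1 ▸ le_iSup g x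
  have hmin : Measurable fun x => min (h x) 1 := hh.min measurable_const
  have hne : ∀ {a : ℝ≥0∞}, a ≤ 1 → a ≠ ⊤ := fun ha => ne_top_of_le_ne_top ENNReal.one_ne_top ha
  calc (∫⁻ x, f x) + (∫⁻ x, g x) ≤ 2 * ∫⁻ x, min (h x) 1 := ?_
    _ ≤ 2 * ∫⁻ x, h x := by gcongr; exact min_le_left _ _
  rw [lintegral_eq_lintegral_ofReal_lt _ hf fun x => hne (hf_le x),
    lintegral_eq_lintegral_ofReal_lt _ hg fun x => hne (hg_le x),
    lintegral_eq_lintegral_ofReal_lt _ hmin fun x => hne (min_le_right _ _),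
    ← lintegral_const_mul' _ _ ENNReal.ofNat_ne_top]
  refine (le_lintegral_add _ _).trans (setLIntegral_mono' measurableSet_Ioi fun t _ => ?_)
  set s := ENNReal.ofReal t
  have hmeas : ∀ {k : ℝ → ℝ≥0∞}, Measurable k → MeasurableSet {x | s < k x} := fun hk =>
    measurableSet_lt measurable_const hk
  rcases lt_or_ge s 1 with hs | hs
  · have hfs : ∃ x, s < f x := lt_iSup_iff.1 (hs.trans_eq hf1.symm)
    have hgs : ∃ x, s < g x := lt_iSup_iff.1 (hs.trans_eq hg1.symm)
    refine Real.volume_add_volume_le (hmeas hf) (hmeas hg)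
      hfs hgs fun x hx y hy => ?_
    refine lt_min ?_ hs
    refine lt_of_not_ge fun hle => (H x y).not_gt ((pow_le_pow_left' hle 2).trans_lt ?_)
    rw [sq]
    exact ENNReal.mul_lt_mul hx hy
  · have h1 : {x | s < f x} = ∅ := eq_empty_of_forall_notMem fun x hx =>
      (((hf_le x).trans hs).not_gt hx)
    have h2 : {x | s < g x} = ∅ := eq_empty_of_forall_notMem fun x hx =>
      (((hg_le x).trans hs).not_gt hx)
    simp [h1, h2]

theorem midpoint_of_iSup_ne_top {f g h : ℝ → ℝ≥0∞} (hf : Measurable f)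
    (hg : Measurable g) (hh : Measurable h) (hf_top : ⨆ x, f x ≠ ⊤) (hg_top : ⨆ x, g x ≠ ⊤)
    (H : ∀ x y, f x * g y ≤ h ((x + y) / 2) ^ 2) :
    (∫⁻ x, f x) * (∫⁻ x, g x) ≤ (∫⁻ x, h x) ^ 2 := by
  set a := ⨆ x, f x with ha
  set b := ⨆ x, g x with hb
  rcases eq_or_ne a 0 with ha0 | ha0
  · simp [ENNReal.iSup_eq_zero.1 ha0]
  rcases eq_or_ne b 0 with hb0 | hb0
  · simp [ENNReal.iSup_eq_zero.1 hb0]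
  obtain ⟨c, hc⟩ : ∃ c : ℝ≥0∞, c ^ 2 = a * b :=
    ⟨(a * b) ^ (1 / 2 : ℝ), by rw [← ENNReal.rpow_natCast, ← ENNReal.rpow_mul]; norm_num⟩
  have hab0 : a * b ≠ 0 := mul_ne_zero ha0 hb0
  have hab_top : a * b ≠ ⊤ := ENNReal.mul_ne_top hf_top hg_top
  have hinv : (c⁻¹) ^ 2 = a⁻¹ * b⁻¹ := by
    rw [← ENNReal.inv_pow, hc, ENNReal.mul_inv (Or.inl ha0) (Or.inl hf_top)]
  have key : (∫⁻ x, a⁻¹ * f x) * (∫⁻ x, b⁻¹ * g x) ≤ (∫⁻ x, c⁻¹ * h x) ^ 2 := by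
    refine ENNReal.mul_le_sq_of_add_le_two_mul (lintegral_add_le_of_iSup_eq_one
      (hf.const_mul _) (hg.const_mul _) (hh.const_mul _) ?_ ?_ fun x y => ?_)
    · rw [← ENNReal.mul_iSup, ENNReal.inv_mul_cancel ha0 hf_top]
    · rw [← ENNReal.mul_iSup, ENNReal.inv_mul_cancel hb0 hg_top]
    · rw [mul_mul_mul_comm, mul_pow, hinv]
      gcongr
      exact H x y
  rw [lintegral_const_mul _ hf, lintegral_const_mul _ hg, lintegral_const_mul _ hh,
    mul_mul_mul_comm, mul_pow, hinv] at key
  rw [← ENNReal.mul_inv (Or.inl ha0) (Or.inl hf_top)] at key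
  exact (ENNReal.mul_le_mul_iff_right (ENNReal.inv_ne_zero.2 hab_top)
    (ENNReal.inv_ne_top.2 hab0)).1 key

/-- One-dimensional Prékopa–Leindler inequality. -/
theorem midpoint : PrekopaLeindler (volume : Measure ℝ) (fun x y z => x + y = 2 * z) := by
  intro f g h hf hg hh H
  rw [lintegral_eq_iSup_min_natCast hf, lintegral_eq_iSup_min_natCast hg, ENNReal.iSup_mul]
  refine iSup_le fun m => ?_
  rw [ENNReal.mul_iSup]
  refine iSup_le fun n => ?_
  refine midpoint_of_iSup_ne_top (hf.min measurable_const) (hg.min measurable_const) hh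
    (ne_top_of_le_ne_top (ENNReal.natCast_ne_top m) (iSup_le fun x => min_le_right _ _))
    (ne_top_of_le_ne_top (ENNReal.natCast_ne_top n) (iSup_le fun x => min_le_right _ _))
    fun x y => ?_
  refine le_trans ?_ (H x y ((x + y) / 2) (by ring))
  gcongr <;> exact min_le_left _ _

/-- Multiplicative form of the one-dimensional Prékopa–Leindler inequality. -/
theorem geomMean : PrekopaLeindler (volume : Measure ℝ) (fun x y z => |x * y| = z ^ 2) := by
  intro f g h hf hg hh H
  rw [lintegral_eq_lintegral_exp hf, lintegral_eq_lintegral_exp hg, lintegral_eq_lintegral_exp hh]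
  have hexp : ∀ {k : ℝ → ℝ≥0∞} (a : ℝ), Measurable k →
      Measurable fun u => ENNReal.ofReal (Real.exp u) * k (a * Real.exp u) := fun a hk =>
    Real.measurable_exp.ennreal_ofReal.mul (hk.comp (Real.measurable_exp.const_mul a))
  have key : ∀ a b c : ℝ, |a| = 1 → |b| = 1 → |c| = 1 →
      (∫⁻ u, ENNReal.ofReal (Real.exp u) * f (a * Real.exp u)) *
        (∫⁻ u, ENNReal.ofReal (Real.exp u) * g (b * Real.exp u)) ≤
        (∫⁻ u, ENNReal.ofReal (Real.exp u) * h (c * Real.exp u)) ^ 2 := by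
    intro a b c ha hb hc
    refine midpoint _ _ _ (hexp a hf) (hexp b hg) (hexp c hh) fun u v w huvw => ?_
    have hexp_mul : Real.exp u * Real.exp v = Real.exp w ^ 2 := by
      rw [← Real.exp_add, huvw, two_mul, Real.exp_add, sq]
    rw [mul_mul_mul_comm, mul_pow, ← ENNReal.ofReal_mul (Real.exp_pos _).le, hexp_mul,
      ENNReal.ofReal_pow (Real.exp_pos _).le]
    gcongr
    refine H _ _ _ ?_
    change |a * Real.exp u * (b * Real.exp v)| = (c * Real.exp w) ^ 2
    rw [mul_mul_mul_comm, hexp_mul, abs_mul, abs_mul, ha, hb, mul_pow, ← sq_abs c, hc]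
    simp
  set F₁ := ∫⁻ u, ENNReal.ofReal (Real.exp u) * f (1 * Real.exp u)
  set F₂ := ∫⁻ u, ENNReal.ofReal (Real.exp u) * f (-1 * Real.exp u)
  set G₁ := ∫⁻ u, ENNReal.ofReal (Real.exp u) * g (1 * Real.exp u)
  set G₂ := ∫⁻ u, ENNReal.ofReal (Real.exp u) * g (-1 * Real.exp u)
  set H₁ := ∫⁻ u, ENNReal.ofReal (Real.exp u) * h (1 * Real.exp u)
  set H₂ := ∫⁻ u, ENNReal.ofReal (Real.exp u) * h (-1 * Real.exp u)
  have key_min : ∀ a b : ℝ, |a| = 1 → |b| = 1 →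
      (∫⁻ u, ENNReal.ofReal (Real.exp u) * f (a * Real.exp u)) *
        (∫⁻ u, ENNReal.ofReal (Real.exp u) * g (b * Real.exp u)) ≤ (min H₁ H₂) ^ 2 := by
    intro a b ha hb
    rcases min_choice H₁ H₂ with hm | hm <;> rw [hm]
    · exact key a b 1 ha hb (by simp)
    · exact key a b (-1) ha hb (by simp)
  calc (F₁ + F₂) * (G₁ + G₂) = F₁ * G₁ + F₁ * G₂ + (F₂ * G₁ + F₂ * G₂) := by ring
    _ ≤ (min H₁ H₂) ^ 2 + (min H₁ H₂) ^ 2 + ((min H₁ H₂) ^ 2 + (min H₁ H₂) ^ 2) := by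
        gcongr <;> exact key_min _ _ (by simp) (by simp)
    _ = (min H₁ H₂ + min H₁ H₂) ^ 2 := by ring
    _ ≤ (H₁ + H₂) ^ 2 := by
        gcongr
        · exact min_le_left _ _
        · exact min_le_right _ _

end PrekopaLeindler

section Symmetrization

variable {ι : Type*}

/-- Symmetrization of `A` in the coordinates in `S`: each fibre `F` of `A` in the direction of
these coordinates is replaced by `(F - F) / 2`. For a singleton `S` and a convex set `A` this is
Steiner symmetrization. -/
def symmetrize (S : Finset ι) (A : Set (ι → ℝ)) : Set (ι → ℝ) :=
  {z | ∃ x ∈ A, ∃ y ∈ A, ∀ j, (j ∈ S → 2 * z j = x j - y j) ∧ (j ∉ S → x j = z j ∧ y j = z j)}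

theorem neg_mem_symmetrize {S : Finset ι} {A : Set (ι → ℝ)} (hA : ∀ x ∈ A, -x ∈ A) :
    ∀ z ∈ symmetrize S A, -z ∈ symmetrize S A := by
  rintro z ⟨x, hx, y, hy, h⟩
  refine ⟨_, hA x hx, _, hA y hy, fun j => ?_⟩
  obtain ⟨h1, h2⟩ := h j
  refine ⟨fun hj => ?_, fun hj => ?_⟩
  · simp only [Pi.neg_apply]
    linarith [h1 hj]
  · simp [h2 hj]

variable [DecidableEq ι]

/-- Change the sign of the coordinates in `S`. -/
def flipSign (S : Finset ι) (x : ι → ℝ) : ι → ℝ := fun j => if j ∈ S then -x j else x j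

theorem flipSign_mem_symmetrize {S T : Finset ι} {A : Set (ι → ℝ)}
    (hA : ∀ x ∈ A, flipSign T x ∈ A) : ∀ z ∈ symmetrize S A, flipSign T z ∈ symmetrize S A := by
  rintro z ⟨x, hx, y, hy, h⟩
  refine ⟨_, hA x hx, _, hA y hy, fun j => ?_⟩
  obtain ⟨h1, h2⟩ := h j
  simp only [flipSign]
  constructor
  · intro hj
    split_ifs <;> linarith [h1 hj]
  · intro hj
    simp [h2 hj]

theorem flipSign_mem_symmetrize_self {S : Finset ι} {A : Set (ι → ℝ)} :
    ∀ z ∈ symmetrize S A, flipSign S z ∈ symmetrize S A := by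
  rintro z ⟨x, hx, y, hy, h⟩
  refine ⟨y, hy, x, hx, fun j => ?_⟩
  obtain ⟨h1, h2⟩ := h j
  refine ⟨fun hj => ?_, fun hj => ?_⟩
  · simp only [flipSign, hj, if_true]
    linarith [h1 hj]
  · simp [flipSign, hj, h2 hj]

theorem IsCompact.symmetrize {S : Finset ι} {A : Set (ι → ℝ)} (hA : IsCompact A) :
    IsCompact (symmetrize S A) := by
  have hcl : IsClosed {w : (ι → ℝ) × (ι → ℝ) | ∀ j, j ∉ S → w.1 j = w.2 j} := by
    simp only [ofPred_forall]
    exact isClosed_iInter fun j => isClosed_iInter fun _ =>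
      isClosed_eq (by fun_prop) (by fun_prop)
  have hcont : Continuous fun w : (ι → ℝ) × (ι → ℝ) =>
      fun j => if j ∈ S then (w.1 j - w.2 j) / 2 else w.1 j := by
    refine continuous_pi fun j => ?_
    split_ifs <;> fun_prop
  convert ((hA.prod hA).inter_right hcl).image hcont using 1
  ext z
  constructor
  · rintro ⟨x, hx, y, hy, h⟩
    refine ⟨(x, y), ⟨⟨hx, hy⟩, fun j hj => ?_⟩, funext fun j => ?_⟩
    · obtain ⟨h1, h2⟩ := (h j).2 hj
      exact h1.trans h2.symm
    · by_cases hj : j ∈ S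
      · simp only [hj, if_true]
        linarith [(h j).1 hj]
      · simp [hj, (h j).2 hj]
  · rintro ⟨⟨x, y⟩, ⟨⟨hx, hy⟩, hxy⟩, rfl⟩
    refine ⟨x, hx, y, hy, fun j => ⟨fun hj => ?_, fun hj => ?_⟩⟩
    · simp only [hj, if_true]
      ring
    · simpa [hj] using (hxy j hj).symm

theorem flipSign_mem_of_singleton {A : Set (ι → ℝ)}
    (hA : ∀ i, ∀ x ∈ A, flipSign {i} x ∈ A) (S : Finset ι) :
    ∀ x ∈ A, flipSign S x ∈ A := by
  induction S using Finset.induction_on with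
  | empty =>
    intro x hx
    rwa [show flipSign ∅ x = x from funext fun j => by simp [flipSign]]
  | insert k S hk ih =>
    intro x hx
    convert hA k _ (ih x hx) using 1
    ext j
    by_cases hj : j = k
    · subst hj
      simp [flipSign, hk]
    · simp [flipSign, hj]

variable [Fintype ι]

theorem volume_le_volume_symmetrize (S : Finset ι) {A : Set (ι → ℝ)} (hA : IsCompact A) :
    volume A ≤ volume (symmetrize S A) := by
  have he := (volume_preserving_piEquivPiSubtypeProd (fun _ : ι => ℝ) (· ∈ S)).symm
  set e := (MeasurableEquiv.piEquivPiSubtypeProd (fun _ : ι => ℝ) (· ∈ S)).symm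
  have e_mem : ∀ u v j (hj : j ∈ S), e (u, v) j = u ⟨j, hj⟩ := fun u v j hj => dif_pos hj
  have e_notMem : ∀ u v j (hj : j ∉ S), e (u, v) j = v ⟨j, hj⟩ := fun u v j hj => dif_neg hj
  have hmA := hA.measurableSet
  have hmS := (hA.symmetrize (S := S)).measurableSet
  rw [← he.measure_preimage hmA.nullMeasurableSet, ← he.measure_preimage hmS.nullMeasurableSet,
    Measure.volume_eq_prod, Measure.prod_apply_symm (e.measurable hmA),
    Measure.prod_apply_symm (e.measurable hmS)]
  refine lintegral_mono fun v => ?_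
  set X : Set ({j // j ∈ S} → ℝ) := (fun u => (u, v)) ⁻¹' (e ⁻¹' A)
  have hX : MeasurableSet X := measurable_prodMk_right (e.measurable hmA)
  have key := PrekopaLeindler.midpoint.pi.measure_mul_le hX
    (Y := Neg.neg ⁻¹' X) (measurable_neg hX)
    (Z := (fun u => (u, v)) ⁻¹' (e ⁻¹' symmetrize S A))
    (measurable_prodMk_right (e.measurable hmS)) ?_
  · rw [Measure.measure_preimage_neg, ← sq] at key
    refine (ENNReal.pow_le_pow_left_iff two_ne_zero).1 ?_
    convert key
  · intro x hx y hy z hz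
    refine ⟨_, hx, _, hy, fun j => ⟨fun hj => ?_, fun hj => ?_⟩⟩
    · rw [e_mem _ _ _ hj, e_mem _ _ _ hj, e_mem _ _ _ hj, Pi.neg_apply, sub_neg_eq_add]
      exact (hz _).symm
    · rw [e_notMem _ _ _ hj, e_notMem _ _ _ hj, e_notMem _ _ _ hj]
      exact ⟨rfl, rfl⟩

/-- Symmetrizing one set of a polar pair in `S` and the other one in the complement of `S`
gives a polar pair. -/
theorem sum_mul_le_one_of_mem_symmetrize {S : Finset ι} {A C : Set (ι → ℝ)}
    (hC : ∀ y ∈ C, -y ∈ C) (hAC : ∀ x ∈ A, ∀ y ∈ C, ∑ i, x i * y i ≤ 1) :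
    ∀ x ∈ symmetrize S A, ∀ y ∈ symmetrize Sᶜ C, ∑ i, x i * y i ≤ 1 := by
  rintro z ⟨x, hx, x', hx', h⟩ w ⟨y, hy, y', hy', h'⟩
  have hzw : ∑ i, z i * w i = (∑ i, x i * y i + ∑ i, x' i * (-y') i) / 2 := by
    rw [← Finset.sum_add_distrib, Finset.sum_div]
    refine Finset.sum_congr rfl fun j _ => ?_
    rw [Pi.neg_apply]
    by_cases hj : j ∈ S
    · obtain ⟨h1, h2⟩ := (h' j).2 (by simpa using hj)
      have h3 := (h j).1 hj
      rw [h1, h2, show z j = (x j - x' j) / 2 by linarith]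
      ring
    · obtain ⟨h1, h2⟩ := (h j).2 hj
      have h3 := (h' j).1 (by simpa using hj)
      rw [h1, h2, show w j = (y j - y' j) / 2 by linarith]
      ring
  rw [hzw]
  linarith [hAC x hx y hy, hAC x' hx' _ (hC y' hy')]

/-- A pair of compact symmetric sets contained in each other's polars. -/
structure IsPolarPair (A C : Set (ι → ℝ)) : Prop where
  isCompact_left : IsCompact A
  isCompact_right : IsCompact C
  neg_mem_left : ∀ x ∈ A, -x ∈ A
  neg_mem_right : ∀ y ∈ C, -y ∈ C
  sum_mul_le_one : ∀ x ∈ A, ∀ y ∈ C, ∑ i, x i * y i ≤ 1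

namespace IsPolarPair

variable {A C : Set (ι → ℝ)}

theorem symmetrize (h : IsPolarPair A C) (S : Finset ι) :
    IsPolarPair (symmetrize S A) (symmetrize Sᶜ C) where
  isCompact_left := h.isCompact_left.symmetrize
  isCompact_right := h.isCompact_right.symmetrize
  neg_mem_left := neg_mem_symmetrize h.neg_mem_left
  neg_mem_right := neg_mem_symmetrize h.neg_mem_right
  sum_mul_le_one := sum_mul_le_one_of_mem_symmetrize h.neg_mem_right h.sum_mul_le_one

theorem exists_flipSign_mem (h : IsPolarPair A C) (F : Finset ι) :
    ∃ A' C' : Set (ι → ℝ), IsPolarPair A' C' ∧ volume A ≤ volume A' ∧ volume C ≤ volume C' ∧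
      ∀ i ∈ F, (∀ x ∈ A', flipSign {i} x ∈ A') ∧ ∀ y ∈ C', flipSign {i} y ∈ C' := by
  induction F using Finset.induction_on with
  | empty => exact ⟨A, C, h, le_rfl, le_rfl, by simp⟩
  | insert k F _ ih =>
    obtain ⟨A', C', h', hA, hC, hF⟩ := ih
    have hk := h'.symmetrize {k}
    refine ⟨_, _, hk, hA.trans (volume_le_volume_symmetrize _ h'.isCompact_left),
      hC.trans (volume_le_volume_symmetrize _ h'.isCompact_right), fun i hi => ?_⟩
    rcases Finset.mem_insert.1 hi with rfl | hi
    · refine ⟨flipSign_mem_symmetrize_self, fun y hy => ?_⟩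
      convert hk.neg_mem_right _ (flipSign_mem_symmetrize_self y hy) using 1
      ext j
      by_cases hj : j = i <;> simp [flipSign, hj]
    · exact ⟨flipSign_mem_symmetrize (hF i hi).1, flipSign_mem_symmetrize (hF i hi).2⟩

theorem sum_abs_mul_le_one (h : IsPolarPair A C) (hA : ∀ i, ∀ x ∈ A, flipSign {i} x ∈ A) :
    ∀ x ∈ A, ∀ y ∈ C, ∑ i, |x i * y i| ≤ 1 := by
  intro x hx y hy
  refine le_of_eq_of_le (Finset.sum_congr rfl fun i _ => ?_)
    (h.sum_mul_le_one _ (flipSign_mem_of_singleton hA {i | x i * y i < 0} x hx) y hy)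
  by_cases hi : x i * y i < 0
  · simp [flipSign, hi, abs_of_neg]
  · simp [flipSign, hi, abs_of_nonneg (not_lt.1 hi)]

/-- Blaschke–Santaló inequality for polar pairs. -/
theorem volume_mul_volume_le (h : IsPolarPair A C) :
    volume A * volume C ≤ volume {x : ι → ℝ | ∑ i, x i ^ 2 ≤ 1} ^ 2 := by
  obtain ⟨A', C', h', hA, hC, hF⟩ := h.exists_flipSign_mem Finset.univ
  refine (mul_le_mul' hA hC).trans (PrekopaLeindler.geomMean.pi.measure_mul_le
    h'.isCompact_left.measurableSet h'.isCompact_right.measurableSet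
    (measurableSet_le (by fun_prop) measurable_const) fun x hx y hy z hz => ?_)
  have := h'.sum_abs_mul_le_one (fun i => (hF i (Finset.mem_univ i)).1) x hx y hy
  exact (Finset.sum_congr rfl fun i _ => (hz i).symm).trans_le this

end IsPolarPair

end Symmetrization

theorem isCompact_euclBall (n : ℕ) : IsCompact (euclBall n) := by
  refine (isCompact_Icc (a := (-1 : Fin n → ℝ)) (b := 1)).of_isClosed_subset
    (isClosed_le (by fun_prop) continuous_const) fun x hx => ?_
  have hx' : ∀ i, |x i| ≤ 1 := fun i => by
    rw [← sq_le_one_iff_abs_le_one]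
    exact (Finset.single_le_sum (f := fun i => x i ^ 2) (fun j _ => sq_nonneg _)
      (Finset.mem_univ i)).trans hx
  exact ⟨fun i => (abs_le.1 (hx' i)).1, fun i => (abs_le.1 (hx' i)).2⟩

theorem isCompact_polarSet {n : ℕ} {B : Set (Fin n → ℝ)} (hB : (0 : Fin n → ℝ) ∈ interior B) :
    IsCompact (polarSet n B) := by
  obtain ⟨r, hr, hrB⟩ := Metric.nhds_basis_closedBall.mem_iff.1 (mem_interior_iff_mem_nhds.1 hB)
  have hcl : IsClosed (polarSet n B) := by
    simp only [polarSet, ofPred_forall]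
    exact isClosed_iInter fun y => isClosed_iInter fun _ =>
      isClosed_le (by fun_prop) continuous_const
  refine (isCompact_Icc (a := fun _ : Fin n => -r⁻¹) (b := fun _ => r⁻¹)).of_isClosed_subset hcl
    fun x hx => ?_
  have key : ∀ i, ∀ s : ℝ, |s| = r → x i * s ≤ 1 := by
    intro i s hs
    have hmem : (Pi.single i s : Fin n → ℝ) ∈ B := hrB <| by
      rw [mem_closedBall_zero_iff, Pi.norm_single, Real.norm_eq_abs, hs]
    simpa [Pi.single_apply] using hx _ hmem
  refine ⟨fun i => ?_, fun i => ?_⟩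
  · have := key i (-r) (by rw [abs_neg, abs_of_pos hr])
    rw [mul_neg, ← neg_mul, ← le_div_iff₀ hr, one_div] at this
    exact neg_le.1 this
  · have := key i r (abs_of_pos hr)
    rwa [← le_div_iff₀ hr, one_div] at this

theorem IsPBall.isPolarPair {n : ℕ} {p : ℝ} {B : Set (Fin n → ℝ)} (hB : IsPBall n p B) :
    IsPolarPair B (polarSet n B) := by
  obtain ⟨hc, hsymm, h0, -⟩ := hB
  have hneg : ∀ x ∈ B, -x ∈ B := fun x hx => by
    rw [hsymm] at hx
    exact hx
  refine ⟨hc, isCompact_polarSet h0, hneg, fun y hy x hx => ?_, fun x hx y hy => ?_⟩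
  · simpa using hy _ (hneg x hx)
  · simpa only [mul_comm] using hy x hx

/-- Upper Santaló bound for `p`-balls: `s(B) ≤ s(B_{ℓ₂ⁿ}) = (|B_{ℓ₂ⁿ}|²)^(1/n)`. -/
theorem pBall_santalo_upper (n : ℕ) (hn : 0 < n) (p : ℝ) (hp : 0 < p) (hp1 : p ≤ 1)
    (B : Set (Fin n → ℝ)) (hB : IsPBall n p B) :
    sVol n B ≤ ((volume (euclBall n)).toReal ^ 2) ^ ((1 : ℝ) / n) := by
  have h := hB.isPolarPair.volume_mul_volume_le
  have hfin : volume (euclBall n) ≠ ⊤ := (isCompact_euclBall n).measure_ne_top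
  refine Real.rpow_le_rpow (by positivity) ?_ (by positivity)
  rw [← ENNReal.toReal_mul, ← ENNReal.toReal_pow]
  exact ENNReal.toReal_mono (ENNReal.pow_ne_top hfin) h
end
end

section
/- Equality case: if B is a p-ball in ℝⁿ with (|B|·|B°|)^(1/n) = (|B_{ℓ₂ⁿ}|²)^(1/n), then B is an ellipsoid. In particular B equals its convex hull. -/
open MeasureTheory Set Pointwise ENNReal

noncomputable section

/-- The cosine transform of a real function on a Euclidean space. -/
def cosTransform {V : Type*} [NormedAddCommGroup V] [InnerProductSpace ℝ V] [MeasureSpace V]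
    (f : V → ℝ) (ξ : V) : ℝ :=
  ∫ x, Real.cos (2 * Real.pi * inner ℝ x ξ) * f x

section CosTransform

variable {V : Type*} [NormedAddCommGroup V] [InnerProductSpace ℝ V] [FiniteDimensional ℝ V]
  [MeasurableSpace V] [BorelSpace V]

lemma integrable_cos_inner_mul {f : V → ℝ} (hf : Integrable f) (ξ : V) :
    Integrable fun x ↦ Real.cos (2 * Real.pi * inner ℝ x ξ) * f x := by
  refine hf.bdd_mul (c := 1) (by fun_prop) ?_
  exact Filter.Eventually.of_forall fun x ↦ by simpa using Real.abs_cos_le_one _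

lemma norm_cos_mul_le (a b : ℝ) : ‖Real.cos a * b‖ ≤ ‖b‖ := by
  rw [norm_mul]
  exact mul_le_of_le_one_left (norm_nonneg b) (Real.abs_cos_le_one a)

lemma continuous_cosTransform {f : V → ℝ} (hf : Integrable f) : Continuous (cosTransform f) := by
  refine continuous_of_dominated (bound := fun x ↦ ‖f x‖) ?_ ?_ hf.norm ?_
  · exact fun ξ ↦ (integrable_cos_inner_mul hf ξ).aestronglyMeasurable
  · exact fun ξ ↦ Filter.Eventually.of_forall fun x ↦ norm_cos_mul_le _ _
  · exact Filter.Eventually.of_forall fun x ↦ by fun_prop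

lemma integral_cosTransform_mul {f g : V → ℝ} (hf : Integrable f) (hg : Integrable g) :
    ∫ ξ, cosTransform f ξ * g ξ = ∫ x, f x * cosTransform g x := by
  simp only [cosTransform, ← integral_mul_const, ← integral_const_mul]
  rw [integral_integral_swap]
  · refine integral_congr_ae (Filter.Eventually.of_forall fun x ↦ ?_)
    refine integral_congr_ae (Filter.Eventually.of_forall fun ξ ↦ ?_)
    simp only [real_inner_comm ξ x]
    ring
  · have h : Integrable (fun z : V × V ↦ g z.1 * f z.2) (volume.prod volume) := hg.mul_prod hf
    refine (h.bdd_mul (c := 1)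
      (f := fun z : V × V ↦ Real.cos (2 * Real.pi * inner ℝ z.2 z.1)) ?_ ?_).congr ?_
    · exact Continuous.aestronglyMeasurable (by fun_prop)
    · exact Filter.Eventually.of_forall fun x ↦ by simpa using Real.abs_cos_le_one _
    · exact Filter.Eventually.of_forall fun z ↦ by simp only [Function.uncurry]; ring

lemma tendsto_cosTransform {f : ℕ → V → ℝ} {g b : V → ℝ}
    (hf : ∀ k, AEStronglyMeasurable (f k)) (hb : Integrable b) (hfb : ∀ k x, ‖f k x‖ ≤ b x)
    (hlim : ∀ x, Filter.Tendsto (fun k ↦ f k x) Filter.atTop (nhds (g x))) (ξ : V) :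
    Filter.Tendsto (fun k ↦ cosTransform (f k) ξ) Filter.atTop (nhds (cosTransform g ξ)) := by
  refine tendsto_integral_of_dominated_convergence b (fun k ↦ ?_) hb (fun k ↦ ?_) ?_
  · exact (Continuous.aestronglyMeasurable (by fun_prop)).mul (hf k)
  · exact Filter.Eventually.of_forall fun x ↦ (norm_cos_mul_le _ _).trans (hfb k x)
  · exact Filter.Eventually.of_forall fun x ↦ (hlim x).const_mul _

lemma cosTransform_eq_of_norm_eq {f : V → ℝ} (hf : ∀ x y, ‖x‖ = ‖y‖ → f x = f y) {ξ η : V}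
    (h : ‖ξ‖ = ‖η‖) : cosTransform f ξ = cosTransform f η := by
  set A := (ℝ ∙ (ξ - η))ᗮ.reflection
  have hA : A ξ = η := Submodule.reflection_sub h
  unfold cosTransform
  rw [← A.measurePreserving.integral_comp A.toHomeomorph.measurableEmbedding
    fun x ↦ Real.cos (2 * Real.pi * inner ℝ x η) * f x]
  refine integral_congr_ae (Filter.Eventually.of_forall fun x ↦ ?_)
  dsimp only
  rw [← hA, A.inner_map_map, hf (A x) x (A.norm_map x)]

lemma re_fourier_ofReal {f : V → ℝ} (hf : Integrable f) (ξ : V) :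
    (FourierTransform.fourier (fun x ↦ (f x : ℂ)) ξ).re = cosTransform f ξ := by
  rw [Real.fourier_eq']
  have hi : Integrable fun v : V ↦
      Complex.exp (↑(-2 * Real.pi * inner ℝ v ξ) * Complex.I) • (f v : ℂ) := by
    refine hf.ofReal.bdd_mul (c := 1) (Continuous.aestronglyMeasurable (by fun_prop)) ?_
    exact Filter.Eventually.of_forall fun x ↦ by rw [Complex.norm_exp_ofReal_mul_I]
  have := integral_re (𝕜 := ℂ) hi
  refine this.symm.trans ?_
  rw [cosTransform]
  refine integral_congr_ae (Filter.Eventually.of_forall fun x ↦ ?_)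
  simp only [smul_eq_mul, RCLike.re_eq_complex_re, Complex.mul_re, Complex.ofReal_re,
    Complex.ofReal_im, Complex.exp_ofReal_mul_I_re, mul_zero, sub_zero]
  rw [← Real.cos_neg]
  congr 2
  ring

lemma fourier_ofReal_of_even {f : V → ℝ} (hf : Integrable f) (he : ∀ x, f (-x) = f x) (ξ : V) :
    FourierTransform.fourier (fun x ↦ (f x : ℂ)) ξ = (cosTransform f ξ : ℂ) := by
  have h1 : FourierTransform.fourier (fun x ↦ (f x : ℂ)) (-ξ)
      = FourierTransform.fourier (fun x ↦ (f x : ℂ)) ξ := by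
    have := Real.fourier_comp_linearIsometry (LinearIsometryEquiv.neg ℝ) (fun x : V ↦ (f x : ℂ)) ξ
    simpa [Function.comp_def, he] using this.symm
  have h2 : FourierTransform.fourier (fun x ↦ (f x : ℂ)) (-ξ)
      = (starRingEnd ℂ) (FourierTransform.fourier (fun x ↦ (f x : ℂ)) ξ) := by
    rw [Real.fourier_eq', Real.fourier_eq', ← integral_conj]
    refine integral_congr_ae (Filter.Eventually.of_forall fun x ↦ ?_)
    simp [← Complex.exp_conj, Complex.conj_ofNat]
  rw [← re_fourier_ofReal hf]
  exact (Complex.conj_eq_iff_re.mp (h2.symm.trans h1)).symm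

lemma contDiff_ofReal_comp {W : Type*} [NormedAddCommGroup W] [NormedSpace ℝ W] {f : W → ℝ}
    (hs : ContDiff ℝ (⊤ : ℕ∞) f) :
    ContDiff ℝ (⊤ : ℕ∞) fun x ↦ (f x : ℂ) :=
  ContDiff.comp (g := Complex.ofRealCLM) (ContinuousLinearMap.contDiff _) hs

lemma integrable_cosTransform {f : V → ℝ} (hf : HasCompactSupport f) (hs : ContDiff ℝ (⊤ : ℕ∞) f) :
    Integrable (cosTransform f) := by
  have hc : HasCompactSupport fun x ↦ (f x : ℂ) :=
    hf.comp_left (g := fun y : ℝ ↦ (y : ℂ)) Complex.ofReal_zero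
  have hd := contDiff_ofReal_comp hs
  have hi : Integrable f := hs.continuous.integrable_of_hasCompactSupport hf
  have := (FourierTransform.fourier (hc.toSchwartzMap (hd))).integrable (μ := volume)
  refine this.re.congr (Filter.Eventually.of_forall fun ξ ↦ ?_)
  simp only [SchwartzMap.fourier_coe]
  exact re_fourier_ofReal hi ξ

lemma integral_cosTransform_sq_le {f : V → ℝ} (hf : HasCompactSupport f)
    (hs : ContDiff ℝ (⊤ : ℕ∞) f) :
    Integrable (fun ξ ↦ cosTransform f ξ ^ 2) ∧ ∫ ξ, cosTransform f ξ ^ 2 ≤ ∫ x, f x ^ 2 := by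
  have hc : HasCompactSupport fun x ↦ (f x : ℂ) :=
    hf.comp_left (g := fun y : ℝ ↦ (y : ℂ)) Complex.ofReal_zero
  have hd := contDiff_ofReal_comp hs
  have hi : Integrable f := hs.continuous.integrable_of_hasCompactSupport hf
  set g := hc.toSchwartzMap (hd) with hg
  have hgi : Integrable fun ξ ↦ ‖FourierTransform.fourier g ξ‖ ^ 2 := by
    have := ((FourierTransform.fourier g).memLp 2 volume)
    exact (memLp_two_iff_integrable_sq_norm this.1).mp this
  have hle : ∀ ξ, cosTransform f ξ ^ 2 ≤ ‖FourierTransform.fourier g ξ‖ ^ 2 := by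
    intro ξ
    rw [← re_fourier_ofReal hi, sq_le_sq, abs_norm, SchwartzMap.fourier_coe]
    exact Complex.abs_re_le_norm _
  have h_int : Integrable (fun ξ ↦ cosTransform f ξ ^ 2) := by
    refine hgi.mono' ((continuous_cosTransform hi).pow 2).aestronglyMeasurable ?_
    refine Filter.Eventually.of_forall fun ξ ↦ ?_
    rw [Real.norm_of_nonneg (sq_nonneg _)]
    exact hle ξ
  refine ⟨h_int, (integral_mono h_int hgi hle).trans ?_⟩
  rw [SchwartzMap.integral_norm_sq_fourier]
  refine (integral_congr_ae (Filter.Eventually.of_forall fun x ↦ ?_)).le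
  simp [hg]

lemma cosTransform_cosTransform {f : V → ℝ} (hf : HasCompactSupport f) (hs : ContDiff ℝ (⊤ : ℕ∞) f)
    (he : ∀ x, f (-x) = f x) (x : V) : cosTransform (cosTransform f) x = f x := by
  have hc : HasCompactSupport fun x ↦ (f x : ℂ) :=
    hf.comp_left (g := fun y : ℝ ↦ (y : ℂ)) Complex.ofReal_zero
  have hd := contDiff_ofReal_comp hs
  have hi : Integrable f := hs.continuous.integrable_of_hasCompactSupport hf
  have hci := integrable_cosTransform hf hs
  have hF : FourierTransform.fourier (fun x ↦ (f x : ℂ)) = fun ξ ↦ (cosTransform f ξ : ℂ) :=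
    funext (fourier_ofReal_of_even hi he)
  have key := congrFun (hd.continuous.fourierInv_fourier_eq hi.ofReal
    (by rw [hF]; exact hci.ofReal)) x
  rw [hF, Real.fourierInv_eq_fourier_neg, fourier_ofReal_of_even hci] at key
  · have := Complex.ofReal_injective key
    rw [← this]
    simp [cosTransform]
  · intro ξ
    simp [cosTransform]

end CosTransform

lemma integral_euclideanSpace_succ {m : ℕ} {f : EuclideanSpace ℝ (Fin (m + 1)) → ℝ}
    (hf : Integrable f) :
    ∫ x, f x = ∫ s : ℝ, ∫ y : Fin m → ℝ, f (WithLp.toLp 2 (Fin.cons s y)) := by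
  have h1 := (PiLp.volume_preserving_toLp (Fin (m + 1)))
  have h2 := (volume_preserving_piFinSuccAbove (fun _ : Fin (m + 1) ↦ ℝ) 0).symm
  have e1 : MeasurableEmbedding (WithLp.toLp 2 : (Fin (m + 1) → ℝ) → EuclideanSpace ℝ _) :=
    (MeasurableEquiv.toLp 2 (Fin (m + 1) → ℝ)).measurableEmbedding
  have h3 := (MeasurableEquiv.measurableEmbedding
    (MeasurableEquiv.piFinSuccAbove (fun _ : Fin (m + 1) ↦ ℝ) 0).symm)
  rw [← h1.integral_comp e1, ← h2.integral_comp h3]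
  have hi := (h2.integrable_comp_emb h3).mpr ((h1.integrable_comp_emb e1).mpr hf)
  rw [Measure.volume_eq_prod]
  refine (integral_prod _ hi).trans ?_
  simp [MeasurableEquiv.piFinSuccAbove, Fin.consEquiv]

/-- The mass of `max (1 - |y|²) 0 ^ k` over `ℝᵐ`. -/
def bumpMass (m k : ℕ) : ℝ := ∫ y : Fin m → ℝ, max (1 - ∑ i, y i ^ 2) 0 ^ k

lemma norm_sq_le_sum_sq {m : ℕ} (y : Fin m → ℝ) : ‖y‖ ^ 2 ≤ ∑ i, y i ^ 2 := by
  have h0 : 0 ≤ ∑ i, y i ^ 2 := Finset.sum_nonneg fun i _ ↦ sq_nonneg _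
  rw [← Real.le_sqrt (norm_nonneg _) h0, pi_norm_le_iff_of_nonneg (Real.sqrt_nonneg _)]
  intro i
  refine Real.abs_le_sqrt ?_
  exact Finset.single_le_sum (f := fun i ↦ y i ^ 2) (fun i _ ↦ sq_nonneg _) (Finset.mem_univ i)

lemma bumpMass_pos (m k : ℕ) : 0 < bumpMass m (k + 1) := by
  refine Continuous.integral_pos_of_hasCompactSupport_nonneg_nonzero (x := 0) (by fun_prop) ?_ ?_
    (by simp)
  · refine HasCompactSupport.of_support_subset_isCompact (isCompact_closedBall 0 1) fun y hy ↦ ?_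
    rw [mem_closedBall_zero_iff]
    by_contra! h
    refine hy ?_
    have := norm_sq_le_sum_sq y
    change max (1 - ∑ i, y i ^ 2) 0 ^ (k + 1) = 0
    rw [max_eq_right (by nlinarith), zero_pow (by simp)]
  · exact fun y ↦ by positivity

lemma integral_max_sub_sum_sq (m k : ℕ) (r : ℝ) :
    ∫ y : Fin m → ℝ, max (r - ∑ i, y i ^ 2) 0 ^ (k + 1)
      = bumpMass m (k + 1) * (√(max r 0) ^ m * max r 0 ^ (k + 1)) := by
  rcases le_or_gt r 0 with hr | hr
  · rw [max_eq_right hr]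
    have : ∀ y : Fin m → ℝ, max (r - ∑ i, y i ^ 2) 0 = 0 := fun y ↦
      max_eq_right (by have : 0 ≤ ∑ i, y i ^ 2 := Finset.sum_nonneg fun i _ ↦ sq_nonneg _
                       linarith)
    simp [this]
  · rw [max_eq_left hr.le]
    have hs : 0 < √r := Real.sqrt_pos.mpr hr
    have h := Measure.integral_comp_smul volume
      (fun y : Fin m → ℝ ↦ max (r - ∑ i, y i ^ 2) 0 ^ (k + 1)) (√r)
    have h' : ∀ y : Fin m → ℝ, max (r - ∑ i, (√r • y) i ^ 2) 0 ^ (k + 1)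
        = r ^ (k + 1) * max (1 - ∑ i, y i ^ 2) 0 ^ (k + 1) := by
      intro y
      rw [← mul_pow, mul_max_of_nonneg _ _ hr.le, mul_zero, mul_sub, mul_one, Finset.mul_sum]
      simp [mul_pow, Real.sq_sqrt hr.le]
    simp only [h', integral_const_mul, Module.finrank_fin_fun, smul_eq_mul] at h
    rw [abs_of_pos (by positivity)] at h
    rw [bumpMass, mul_comm, mul_assoc, h]
    field_simp

lemma integral_ridge_mul_bump {m : ℕ} (k : ℕ) {β : ℝ → ℝ} (hβ : Continuous β) :
    ∫ x : EuclideanSpace ℝ (Fin (m + 1)), β (x 0) * max (1 - ‖x‖ ^ 2) 0 ^ (k + 1)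
      = bumpMass m (k + 1) *
        ∫ s, β s * (√(max (1 - s ^ 2) 0) ^ m * max (1 - s ^ 2) 0 ^ (k + 1)) := by
  rw [integral_euclideanSpace_succ, ← integral_const_mul]
  · refine integral_congr_ae (Filter.Eventually.of_forall fun s ↦ ?_)
    simp only [EuclideanSpace.real_norm_sq_eq, Fin.sum_univ_succ, Fin.cons_zero, Fin.cons_succ,
      ← sub_sub, integral_const_mul, integral_max_sub_sum_sq]
    ring
  · refine Continuous.integrable_of_hasCompactSupport (by fun_prop) ?_
    refine HasCompactSupport.of_support_subset_isCompact (isCompact_closedBall 0 1) fun y hy ↦ ?_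
    rw [mem_closedBall_zero_iff]
    by_contra! h
    refine hy ?_
    change β (y 0) * max (1 - ‖y‖ ^ 2) 0 ^ (k + 1) = 0
    rw [max_eq_right (by nlinarith), zero_pow (by simp), mul_zero]

/-- Injectivity of the Abel transform on even continuous functions. -/
lemma eq_zero_of_integral_ridge_mul_bump {m : ℕ} {β : ℝ → ℝ} (hβ : Continuous β)
    (he : ∀ s, β (-s) = β s)
    (h : ∀ k : ℕ, ∫ x : EuclideanSpace ℝ (Fin (m + 1)),
      β (x 0) * max (1 - ‖x‖ ^ 2) 0 ^ (k + 1) = 0) {s : ℝ} (hs : |s| ≤ 1) : β s = 0 := by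
  set w : ℝ → ℝ := fun s ↦ √(max (1 - s ^ 2) 0) ^ m * max (1 - s ^ 2) 0 with hw
  have hwc : Continuous w := by fun_prop
  have hw0 : ∀ s, 0 ≤ w s := fun s ↦ by positivity
  have hws : HasCompactSupport w := by
    refine HasCompactSupport.of_support_subset_isCompact (isCompact_closedBall 0 1) fun y hy ↦ ?_
    rw [mem_closedBall_zero_iff, Real.norm_eq_abs]
    by_contra! h
    refine hy ?_
    have : 1 < y ^ 2 := (one_lt_sq_iff_one_lt_abs y).mpr h
    simp only [hw]
    rw [max_eq_right (a := 1 - y ^ 2) (by linarith), mul_zero]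
  have h_int : ∀ g : ℝ → ℝ, Continuous g → Integrable fun s ↦ g s * w s := fun g hg ↦
    (hg.mul hwc).integrable_of_hasCompactSupport hws.mul_left
  have hmono : ∀ k : ℕ, ∫ s, (β s * (1 - s ^ 2) ^ k) * w s = 0 := by
    intro k
    have h1 := h k
    rw [integral_ridge_mul_bump k hβ] at h1
    rw [← (mul_eq_zero.mp h1).resolve_left (bumpMass_pos m k).ne']
    refine integral_congr_ae (Filter.Eventually.of_forall fun s ↦ ?_)
    simp only [hw]
    rcases le_or_gt (1 - s ^ 2) 0 with h2 | h2
    · simp [max_eq_right h2]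
    · simp only [max_eq_left h2.le]; ring
  have hpoly : ∀ q : Polynomial ℝ, ∫ s, (β s * q.eval (1 - s ^ 2)) * w s = 0 := by
    intro q
    simp only [Polynomial.eval_eq_sum_range, Finset.mul_sum, Finset.sum_mul]
    rw [integral_finsetSum]
    · refine Finset.sum_eq_zero fun k _ ↦ ?_
      rw [← mul_zero (q.coeff k), ← hmono k, ← integral_const_mul]
      refine integral_congr_ae (Filter.Eventually.of_forall fun s ↦ ?_)
      ring
    · exact fun k _ ↦ h_int _ (by fun_prop)
  have hsq : ∫ s, (β s * β s) * w s = 0 := by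
    set C := ∫ s, |β s| * w s with hC
    have hC0 : 0 ≤ C := integral_nonneg fun s ↦ mul_nonneg (abs_nonneg _) (hw0 s)
    refine le_antisymm (le_of_forall_pos_le_add fun ε hε ↦ ?_)
      (integral_nonneg fun s ↦ mul_nonneg (mul_self_nonneg _) (hw0 s))
    obtain ⟨q, hq⟩ := exists_polynomial_near_of_continuousOn 0 1 (fun v ↦ β (√(1 - v)))
      (by fun_prop) (ε / (C + 1)) (by positivity)
    have hb : ∀ s, (β s * β s) * w s
        ≤ (β s * q.eval (1 - s ^ 2)) * w s + ε / (C + 1) * (|β s| * w s) := by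
      intro s
      rcases le_or_gt (1 - s ^ 2) 0 with h2 | h2
      · simp [hw, max_eq_right h2]
      · have h3 := hq (1 - s ^ 2) ⟨h2.le, by nlinarith [sq_nonneg s]⟩
        have h4 : β (√(1 - (1 - s ^ 2))) = β s := by
          rw [_root_.sub_sub_cancel, Real.sqrt_sq_eq_abs]
          rcases abs_choice s with h | h <;> simp [h, he]
        rw [h4] at h3
        have h5 : β s * (β s - q.eval (1 - s ^ 2)) ≤ |β s| * (ε / (C + 1)) := by
          refine (le_abs_self _).trans ?_
          rw [abs_mul, abs_sub_comm]
          exact mul_le_mul_of_nonneg_left h3.le (abs_nonneg _)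
        nlinarith [mul_le_mul_of_nonneg_right h5 (hw0 s)]
    have := integral_mono (h_int _ (hβ.mul hβ))
      ((h_int (fun s ↦ β s * q.eval (1 - s ^ 2)) (by fun_prop)).add
        ((h_int (fun s ↦ |β s|) hβ.abs).const_mul (ε / (C + 1)))) hb
    simp only [Pi.add_apply] at this
    rw [integral_add (h_int (fun s ↦ β s * q.eval (1 - s ^ 2)) (by fun_prop))
        ((h_int (fun s ↦ |β s|) hβ.abs).const_mul (ε / (C + 1))),
      hpoly, integral_const_mul, ← hC] at this
    refine this.trans ?_
    have : ε / (C + 1) * C ≤ ε := by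
      rw [div_mul_eq_mul_div, div_le_iff₀ (by positivity)]
      nlinarith
    linarith
  have hzero : (fun s ↦ (β s * β s) * w s) = 0 :=
    (Continuous.ae_eq_iff_eq volume (by fun_prop) continuous_zero).mp
      ((integral_eq_zero_iff_of_nonneg (fun s ↦ mul_nonneg (mul_self_nonneg _) (hw0 s))
        (h_int _ (hβ.mul hβ))).mp hsq)
  have hopen : ∀ s ∈ Ioo (-1 : ℝ) 1, β s = 0 := by
    intro s hs
    have h1 := congrFun hzero s
    have h2 : 0 < 1 - s ^ 2 := by nlinarith [hs.1, hs.2]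
    have h3 : 0 < w s := by
      simp only [hw, max_eq_left h2.le]
      have := Real.sqrt_pos.mpr h2
      positivity
    simpa [h3.ne'] using h1
  have hcl : IsClosed {s | β s = 0} := isClosed_eq hβ continuous_const
  have := closure_minimal (s := Ioo (-1 : ℝ) 1) hopen hcl
  rw [closure_Ioo (by norm_num)] at this
  exact this (abs_le.mp hs)

section Polar

variable {V : Type*} [NormedAddCommGroup V] [NormedSpace ℝ V] [FiniteDimensional ℝ V]
  [Nontrivial V] [MeasurableSpace V] [BorelSpace V] (μ : Measure V) [μ.IsAddHaarMeasure]

lemma integral_eq_integral_sphere_integral_Ioi {f : V → ℝ} (hf : Integrable f μ) :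
    ∫ x, f x ∂μ = ∫ u : Metric.sphere (0 : V) 1, (∫ t in Ioi (0 : ℝ),
      t ^ (Module.finrank ℝ V - 1) * f (t • (u : V))) ∂μ.toSphere := by
  have hmp := μ.measurePreserving_homeomorphUnitSphereProd
  have hme := (homeomorphUnitSphereProd V).measurableEmbedding
  set g : Metric.sphere (0 : V) 1 × Ioi (0 : ℝ) → ℝ := fun z ↦ f ((z.2 : ℝ) • (z.1 : V)) with hg
  have hfg : ∀ x : ({(0)}ᶜ : Set V), f x = g (homeomorphUnitSphereProd V x) := by
    intro x
    have : ‖(x : V)‖ ≠ 0 := norm_ne_zero_iff.mpr x.2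
    simp [hg, smul_smul, this]
  have hgi : Integrable g (μ.toSphere.prod (.volumeIoiPow (Module.finrank ℝ V - 1))) := by
    rw [← hmp.integrable_comp_emb hme]
    have h1 : Integrable (fun x : ({(0)}ᶜ : Set V) ↦ f x) (μ.comap (↑)) := by
      have := hf.integrableOn (s := {(0)}ᶜ)
      rwa [integrableOn_iff_comap_subtypeVal (by measurability)] at this
    exact h1.congr (Filter.Eventually.of_forall hfg)
  calc
    ∫ x, f x ∂μ = ∫ x : ({(0)}ᶜ : Set V), f x ∂(μ.comap (↑)) := by
      rw [integral_subtype_comap (measurableSet_singleton _).compl fun x ↦ f x,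
        restrict_compl_singleton]
    _ = ∫ z, g z ∂μ.toSphere.prod (.volumeIoiPow (Module.finrank ℝ V - 1)) := by
      rw [← hmp.integral_comp hme]
      exact integral_congr_ae (Filter.Eventually.of_forall hfg)
    _ = _ := by
      rw [integral_prod _ hgi]
      refine integral_congr_ae (Filter.Eventually.of_forall fun u ↦ ?_)
      simp only [hg, Measure.volumeIoiPow, ENNReal.ofReal]
      rw [integral_withDensity_eq_integral_smul,
        integral_subtype_comap measurableSet_Ioi fun a ↦
          Real.toNNReal (a ^ (Module.finrank ℝ V - 1)) • f (a • (u : V)),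
        setIntegral_congr_fun measurableSet_Ioi fun x hx ↦ ?_]
      · simp only [NNReal.smul_def, Real.coe_toNNReal _ (pow_nonneg (le_of_lt hx) _), smul_eq_mul]
      · exact (measurable_subtype_coe.pow_const _).real_toNNReal

variable {μ} {h : V → ℝ}

lemma measure_sublevel (h1 : ∀ t : ℝ, 0 < t → ∀ x, h (t • x) = t * h x)
    (h2 : ∀ x, x ≠ 0 → 0 < h x) (t : ℝ) :
    μ {x | h x ≤ t} = ENNReal.ofReal t ^ Module.finrank ℝ V * μ {x | h x ≤ 1} := by
  have hfr : Module.finrank ℝ V ≠ 0 := Module.finrank_pos.ne'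
  have h0 : h 0 = 0 := by
    have := h1 2 (by norm_num) 0
    rw [smul_zero] at this
    linarith
  rcases le_or_gt t 0 with ht | ht
  · rw [ENNReal.ofReal_of_nonpos ht, zero_pow hfr, zero_mul]
    refine measure_mono_null (t := {0}) (fun x hx ↦ ?_) (measure_singleton 0)
    by_contra hx0
    exact absurd (h2 x hx0) (not_lt.mpr (le_trans hx ht))
  · have : {x | h x ≤ t} = t • {x | h x ≤ 1} := by
      ext x
      rw [mem_smul_set_iff_inv_smul_mem₀ ht.ne', mem_ofPred_eq, mem_ofPred_eq,
        h1 _ (inv_pos.mpr ht), inv_mul_le_iff₀ ht, mul_one]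
    rw [this, Measure.addHaar_smul_of_nonneg _ ht.le, ENNReal.ofReal_pow ht.le]

lemma measure_sublevel_lt_top (hc : Continuous h)
    (h1 : ∀ t : ℝ, 0 < t → ∀ x, h (t • x) = t * h x)
    (h2 : ∀ x, x ≠ 0 → 0 < h x) : μ {x | h x ≤ 1} < ⊤ := by
  obtain ⟨u, hu, hmin⟩ := (isCompact_sphere (0 : V) 1).exists_isMinOn
    (NormedSpace.sphere_nonempty.mpr zero_le_one) hc.continuousOn
  have hu0 : 0 < h u := h2 u (by rintro rfl; simp at hu)
  refine (measure_mono (t := Metric.closedBall 0 (h u)⁻¹) fun x hx ↦ ?_).trans_lt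
    measure_closedBall_lt_top
  rw [mem_closedBall_zero_iff]
  rcases eq_or_ne x 0 with rfl | hx0
  · simpa using hu0.le
  · have hn : 0 < ‖x‖ := norm_pos_iff.mpr hx0
    have h3 : h u ≤ h (‖x‖⁻¹ • x) := hmin (by simp [norm_smul, hn.ne'])
    rw [h1 _ (inv_pos.mpr hn)] at h3
    rw [← one_div, le_div_iff₀ hu0]
    calc ‖x‖ * h u ≤ ‖x‖ * (‖x‖⁻¹ * h x) := by gcongr
      _ = h x := by field_simp
      _ ≤ 1 := hx

lemma map_eq_smul_map_norm (hc : Continuous h)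
    (h1 : ∀ t : ℝ, 0 < t → ∀ x, h (t • x) = t * h x) (h2 : ∀ x, x ≠ 0 → 0 < h x) :
    μ.map h = (μ {x | h x ≤ 1} / μ (Metric.closedBall 0 1)) • μ.map norm := by
  have hb : ∀ t, {x : V | ‖x‖ ≤ t} = Metric.closedBall 0 t := fun t ↦ by
    ext; simp
  have hnorm := measure_sublevel (μ := μ) (h := (norm : V → ℝ))
    (fun t ht x ↦ by rw [norm_smul, Real.norm_of_nonneg ht.le]) (fun x hx ↦ norm_pos_iff.mpr hx)
  refine Measure.ext_of_generateFrom_of_iUnion (range Iic) (fun n : ℕ ↦ Iic (n : ℝ))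
    (BorelSpace.measurable_eq.trans (borel_eq_generateFrom_Iic ℝ)) isPiSystem_Iic ?_
    (fun n ↦ mem_range_self _) (fun n ↦ ?_) ?_
  · exact iUnion_eq_univ_iff.mpr fun x ↦ exists_nat_ge x
  · rw [Measure.map_apply hc.measurable measurableSet_Iic]
    refine ne_of_lt ((measure_sublevel h1 h2 (n : ℝ)).trans_lt ?_)
    exact ENNReal.mul_lt_top (by finiteness) (measure_sublevel_lt_top hc h1 h2)
  · rintro _ ⟨t, rfl⟩
    rw [Measure.map_apply hc.measurable measurableSet_Iic, Measure.smul_apply,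
      Measure.map_apply continuous_norm.measurable measurableSet_Iic]
    change μ {x | h x ≤ t} = _ • μ {x | ‖x‖ ≤ t}
    rw [measure_sublevel h1 h2 t, hnorm t, hb, smul_eq_mul, mul_left_comm,
      ENNReal.div_mul_cancel (Metric.measure_closedBall_pos μ 0 one_pos).ne'
        measure_closedBall_lt_top.ne]

lemma integrable_comp_of_integrable_comp_norm (hc : Continuous h)
    (h1 : ∀ t : ℝ, 0 < t → ∀ x, h (t • x) = t * h x) (h2 : ∀ x, x ≠ 0 → 0 < h x)
    {g : ℝ → ℝ} (hg : Continuous g) (hi : Integrable (fun x : V ↦ g ‖x‖) μ) :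
    Integrable (fun x ↦ g (h x)) μ := by
  have h3 : Integrable g (μ.map h) := by
    rw [map_eq_smul_map_norm hc h1 h2]
    refine Integrable.smul_measure ?_ (ENNReal.div_ne_top (measure_sublevel_lt_top hc h1 h2).ne
      (Metric.measure_closedBall_pos μ 0 one_pos).ne')
    exact (integrable_map_measure hg.aestronglyMeasurable
      continuous_norm.measurable.aemeasurable).mpr hi
  exact (integrable_map_measure hg.aestronglyMeasurable hc.measurable.aemeasurable).mp h3

lemma integral_comp_eq_integral_comp_norm (hc : Continuous h)
    (h1 : ∀ t : ℝ, 0 < t → ∀ x, h (t • x) = t * h x) (h2 : ∀ x, x ≠ 0 → 0 < h x)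
    {g : ℝ → ℝ} (hg : Continuous g) :
    ∫ x, g (h x) ∂μ
      = μ.real {x | h x ≤ 1} / μ.real (Metric.closedBall 0 1) * ∫ x, g ‖x‖ ∂μ := by
  rw [← integral_map (φ := h) hc.measurable.aemeasurable hg.aestronglyMeasurable,
    map_eq_smul_map_norm hc h1 h2, integral_smul_measure,
    integral_map (φ := norm) continuous_norm.measurable.aemeasurable hg.aestronglyMeasurable,
    ENNReal.toReal_div, smul_eq_mul]
  rfl

end Polar

section Euclidean

variable {m : ℕ}

/-- The cosine transform of `t ^ m * T t` on the half line. -/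
def halfLineTransform (m : ℕ) (T : ℝ → ℝ) (s : ℝ) : ℝ :=
  ∫ t in Ioi (0 : ℝ), t ^ m * (Real.cos (2 * Real.pi * (t * s)) * T t)

lemma integrableOn_pow_mul {T : ℝ → ℝ}
    (hT : Integrable fun x : EuclideanSpace ℝ (Fin (m + 1)) ↦ T ‖x‖) :
    IntegrableOn (fun t ↦ t ^ m * T t) (Ioi 0) := by
  simpa using (integrable_fun_norm_addHaar volume).mp hT

lemma norm_pow_mul_cos_mul_le (m : ℕ) (a b t : ℝ) :
    ‖t ^ m * (Real.cos a * b)‖ ≤ ‖t ^ m * b‖ := by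
  rw [norm_mul, norm_mul (t ^ m)]
  exact mul_le_mul_of_nonneg_left (norm_cos_mul_le a b) (norm_nonneg _)

lemma continuous_halfLineTransform {T : ℝ → ℝ} (hc : Continuous T)
    (hT : IntegrableOn (fun t ↦ t ^ m * T t) (Ioi 0)) : Continuous (halfLineTransform m T) := by
  refine continuous_of_dominated (bound := fun t ↦ ‖t ^ m * T t‖) ?_ ?_ hT.norm ?_
  · exact fun s ↦ Continuous.aestronglyMeasurable (by fun_prop)
  · exact fun s ↦ Filter.Eventually.of_forall fun t ↦ norm_pow_mul_cos_mul_le _ _ _ _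
  · exact Filter.Eventually.of_forall fun t ↦ by fun_prop

lemma abs_halfLineTransform_le {T : ℝ → ℝ}
    (hT : IntegrableOn (fun t ↦ t ^ m * T t) (Ioi 0)) (s : ℝ) :
    |halfLineTransform m T s| ≤ ∫ t in Ioi (0 : ℝ), ‖t ^ m * T t‖ :=
  norm_integral_le_of_norm_le hT.norm
    (Filter.Eventually.of_forall fun _ ↦ norm_pow_mul_cos_mul_le _ _ _ _)

lemma cosTransform_comp_norm {T : ℝ → ℝ}
    (hT : Integrable fun x : EuclideanSpace ℝ (Fin (m + 1)) ↦ T ‖x‖)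
    (x : EuclideanSpace ℝ (Fin (m + 1))) :
    cosTransform (fun ξ ↦ T ‖ξ‖) x = ∫ u : Metric.sphere (0 : EuclideanSpace ℝ (Fin (m + 1))) 1,
      halfLineTransform m T (inner ℝ (u : EuclideanSpace ℝ (Fin (m + 1))) x)
        ∂(volume : Measure (EuclideanSpace ℝ (Fin (m + 1)))).toSphere := by
  rw [cosTransform, integral_eq_integral_sphere_integral_Ioi _ (integrable_cos_inner_mul hT x)]
  refine integral_congr_ae (Filter.Eventually.of_forall fun u ↦ ?_)
  refine setIntegral_congr_fun measurableSet_Ioi fun t ht ↦ ?_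
  have ht : 0 < t := ht
  have hu : ‖(u : EuclideanSpace ℝ (Fin (m + 1)))‖ = 1 := norm_eq_of_mem_sphere u
  simp [norm_smul, hu, abs_of_pos ht, real_inner_smul_left]

lemma integral_ridge_eq {β g : ℝ → ℝ} {u : EuclideanSpace ℝ (Fin (m + 1))} (hu : ‖u‖ = 1) :
    ∫ x : EuclideanSpace ℝ (Fin (m + 1)), β (inner ℝ u x) * g ‖x‖
      = ∫ x : EuclideanSpace ℝ (Fin (m + 1)), β (x 0) * g ‖x‖ := by
  set e : EuclideanSpace ℝ (Fin (m + 1)) := EuclideanSpace.single 0 1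
  set A := (ℝ ∙ (u - e))ᗮ.reflection
  have hA : A u = e := Submodule.reflection_sub (by simp [hu, e])
  rw [← A.measurePreserving.integral_comp A.toHomeomorph.measurableEmbedding
    fun x ↦ β (x 0) * g ‖x‖]
  refine integral_congr_ae (Filter.Eventually.of_forall fun x ↦ ?_)
  have : (A x) 0 = inner ℝ u x := by
    rw [← A.inner_map_map u x, hA]
    simp [e, EuclideanSpace.inner_single_left]
  dsimp only
  rw [this, A.norm_map]

/-- If a radial function has a cosine transform equal to `1` on the unit ball, then its
half-line transform is constant on `[-1, 1]`. -/
lemma halfLineTransform_eq {T : ℝ → ℝ} (hc : Continuous T)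
    (hT : Integrable fun x : EuclideanSpace ℝ (Fin (m + 1)) ↦ T ‖x‖)
    (h : ∀ x : EuclideanSpace ℝ (Fin (m + 1)), ‖x‖ ≤ 1 → cosTransform (fun ξ ↦ T ‖ξ‖) x = 1)
    {s : ℝ} (hs : |s| ≤ 1) : halfLineTransform m T s = halfLineTransform m T 0 := by
  have hTi := integrableOn_pow_mul hT
  set α := halfLineTransform m T with hα
  have hαc : Continuous α := continuous_halfLineTransform hc hTi
  set σ := (volume : Measure (EuclideanSpace ℝ (Fin (m + 1)))).toSphere with hσ
  set β : ℝ → ℝ := fun s ↦ α s - α 0 with hβ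
  have hβc : Continuous β := by fun_prop
  suffices β s = 0 from sub_eq_zero.mp this
  refine eq_zero_of_integral_ridge_mul_bump (m := m) hβc (fun s ↦ ?_) (fun k ↦ ?_) hs
  · simp [hβ, hα, halfLineTransform]
  set w : ℝ → ℝ := fun r ↦ max (1 - r ^ 2) 0 ^ (k + 1) with hw
  have hwc : Continuous w := by fun_prop
  have hw1 : ∀ r : ℝ, 0 ≤ r → w r ≠ 0 → r ≤ 1 := by
    intro r hr0 hr
    by_contra! h
    refine hr ?_
    change max (1 - r ^ 2) 0 ^ (k + 1) = 0
    rw [max_eq_right (by nlinarith), zero_pow (by simp)]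
  have hwi : Integrable fun x : EuclideanSpace ℝ (Fin (m + 1)) ↦ w ‖x‖ := by
    refine Continuous.integrable_of_hasCompactSupport (by fun_prop) ?_
    refine HasCompactSupport.of_support_subset_isCompact (isCompact_closedBall 0 1) fun y hy ↦ ?_
    rw [mem_closedBall_zero_iff]
    exact hw1 _ (norm_nonneg _) hy
  have hαs : ∀ x : EuclideanSpace ℝ (Fin (m + 1)), Integrable (fun u : Metric.sphere (0 :
      EuclideanSpace ℝ (Fin (m + 1))) 1 ↦ α (inner ℝ (u : EuclideanSpace ℝ (Fin (m + 1))) x)) σ :=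
    fun x ↦ Continuous.integrable_of_hasCompactSupport (by fun_prop)
      (HasCompactSupport.of_compactSpace _)
  have h1 : ∀ x : EuclideanSpace ℝ (Fin (m + 1)),
      (∫ u : Metric.sphere (0 : EuclideanSpace ℝ (Fin (m + 1))) 1,
        β (inner ℝ (u : EuclideanSpace ℝ (Fin (m + 1))) x) * w ‖x‖ ∂σ) = 0 := by
    intro x
    rw [integral_mul_const]
    rcases eq_or_ne (w ‖x‖) 0 with h0 | h0
    · rw [h0, mul_zero]
    · have h2 := h x (hw1 _ (norm_nonneg _) h0)
      have h3 := h 0 (by simp)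
      rw [cosTransform_comp_norm hT] at h2 h3
      rw [integral_sub (hαs x) (integrable_const _), h2]
      simp only [inner_zero_right] at h3
      rw [h3, sub_self, zero_mul]
  have h2 : ∫ u : Metric.sphere (0 : EuclideanSpace ℝ (Fin (m + 1))) 1,
      (∫ x : EuclideanSpace ℝ (Fin (m + 1)),
        β (inner ℝ (u : EuclideanSpace ℝ (Fin (m + 1))) x) * w ‖x‖) ∂σ = 0 := by
    rw [integral_integral_swap]
    · simp [h1]
    · have hpi : Integrable (fun z : Metric.sphere (0 : EuclideanSpace ℝ (Fin (m + 1))) 1 ×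
          EuclideanSpace ℝ (Fin (m + 1)) ↦ w ‖z.2‖) (σ.prod volume) := hwi.comp_snd σ
      refine hpi.bdd_mul (c := 2 * ∫ t in Ioi (0 : ℝ), ‖t ^ m * T t‖)
        (Continuous.aestronglyMeasurable (by fun_prop)) (Filter.Eventually.of_forall fun z ↦ ?_)
      refine (norm_sub_le _ _).trans ?_
      have := abs_halfLineTransform_le hTi
        (inner ℝ (z.1 : EuclideanSpace ℝ (Fin (m + 1))) z.2)
      have := abs_halfLineTransform_le hTi 0
      simp only [Real.norm_eq_abs, hα] at *
      linarith
  have h3 : ∀ u : Metric.sphere (0 : EuclideanSpace ℝ (Fin (m + 1))) 1,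
      ∫ x : EuclideanSpace ℝ (Fin (m + 1)),
        β (inner ℝ (u : EuclideanSpace ℝ (Fin (m + 1))) x) * w ‖x‖
      = ∫ x : EuclideanSpace ℝ (Fin (m + 1)), β (x 0) * w ‖x‖ := fun u ↦
    integral_ridge_eq (norm_eq_of_mem_sphere u)
  simp only [h3, integral_const, smul_eq_mul, mul_eq_zero] at h2
  refine h2.resolve_left ?_
  rw [measureReal_eq_zero_iff, Measure.measure_univ_eq_zero]
  exact Measure.toSphere_ne_zero volume

lemma cosTransform_comp_eq_integral {T : ℝ → ℝ} (hc : Continuous T)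
    (hT : Integrable fun x : EuclideanSpace ℝ (Fin (m + 1)) ↦ T ‖x‖)
    (h : ∀ x : EuclideanSpace ℝ (Fin (m + 1)), ‖x‖ ≤ 1 → cosTransform (fun ξ ↦ T ‖ξ‖) x = 1)
    {N : EuclideanSpace ℝ (Fin (m + 1)) → ℝ} (hN : Continuous N)
    (hN1 : ∀ t : ℝ, 0 < t → ∀ x, N (t • x) = t * N x) (hN2 : ∀ x, x ≠ 0 → 0 < N x)
    {x : EuclideanSpace ℝ (Fin (m + 1))} (hx : ∀ ξ, |inner ℝ ξ x| ≤ N ξ) :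
    cosTransform (fun ξ ↦ T (N ξ)) x = ∫ ξ, T (N ξ) := by
  have hTN := integrable_comp_of_integrable_comp_norm hN hN1 hN2 hc hT
  have h0 : ∫ ξ, T (N ξ) = cosTransform (fun ξ ↦ T (N ξ)) 0 := by simp [cosTransform]
  have key : ∀ y u : EuclideanSpace ℝ (Fin (m + 1)), ‖u‖ = 1 →
      (∫ t in Ioi (0 : ℝ), t ^ m * (Real.cos (2 * Real.pi * inner ℝ (t • u) y) * T (N (t • u))))
        = ((N u) ^ m)⁻¹ * ((N u)⁻¹ * halfLineTransform m T (inner ℝ u y / N u)) := by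
    intro y u hu
    have ha : 0 < N u := hN2 u (by rintro rfl; simp at hu)
    have := integral_comp_mul_left_Ioi
      (fun t ↦ t ^ m * (Real.cos (2 * Real.pi * (t * (inner ℝ u y / N u))) * T t)) 0 ha
    rw [mul_zero, smul_eq_mul] at this
    rw [halfLineTransform, ← this, ← integral_const_mul]
    refine setIntegral_congr_fun measurableSet_Ioi fun t ht ↦ ?_
    rw [hN1 t ht, real_inner_smul_left, mul_pow, mul_comm t (N u),
      show N u * t * (inner ℝ u y / N u) = t * inner ℝ u y by field_simp]
    field_simp
  rw [h0]
  simp only [cosTransform]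
  rw [integral_eq_integral_sphere_integral_Ioi _ (integrable_cos_inner_mul hTN x),
    integral_eq_integral_sphere_integral_Ioi _ (integrable_cos_inner_mul hTN 0)]
  refine integral_congr_ae (Filter.Eventually.of_forall fun u ↦ ?_)
  have hu : ‖(u : EuclideanSpace ℝ (Fin (m + 1)))‖ = 1 := norm_eq_of_mem_sphere u
  have ha : 0 < N u := hN2 u (by intro h; simp [h] at hu)
  simp only [finrank_euclideanSpace_fin, Nat.add_sub_cancel]
  rw [key x u hu, key 0 u hu, halfLineTransform_eq hc hT h, inner_zero_right, zero_div]
  rw [abs_div, abs_of_pos ha, div_le_one ha]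
  exact hx u

end Euclidean

lemma integral_sq_le_of_tendsto {α : Type*} [MeasurableSpace α] {μ : Measure α}
    {u : ℕ → α → ℝ} {v : α → ℝ} {a : ℕ → ℝ} {A : ℝ}
    (hv : AEStronglyMeasurable v μ) (hu : ∀ k, Integrable (fun x ↦ u k x ^ 2) μ)
    (hua : ∀ k, ∫ x, u k x ^ 2 ∂μ ≤ a k) (ha : Filter.Tendsto a Filter.atTop (nhds A))
    (hlim : ∀ x, Filter.Tendsto (fun k ↦ u k x) Filter.atTop (nhds (v x))) :
    Integrable (fun x ↦ v x ^ 2) μ ∧ ∫ x, v x ^ 2 ∂μ ≤ A := by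
  have hA : 0 ≤ A := ge_of_tendsto' ha fun k ↦ (integral_nonneg fun x ↦ sq_nonneg _).trans (hua k)
  have key : ∫⁻ x, ENNReal.ofReal (v x ^ 2) ∂μ ≤ ENNReal.ofReal A := by
    calc ∫⁻ x, ENNReal.ofReal (v x ^ 2) ∂μ
        = ∫⁻ x, Filter.liminf (fun k ↦ ENNReal.ofReal (u k x ^ 2)) Filter.atTop ∂μ := by
          refine lintegral_congr fun x ↦ ?_
          exact (ENNReal.tendsto_ofReal ((hlim x).pow 2)).liminf_eq.symm
      _ ≤ Filter.liminf (fun k ↦ ∫⁻ x, ENNReal.ofReal (u k x ^ 2) ∂μ) Filter.atTop :=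
          lintegral_liminf_le' fun k ↦ (hu k).aestronglyMeasurable.aemeasurable.ennreal_ofReal
      _ ≤ Filter.liminf (fun k ↦ ENNReal.ofReal (a k)) Filter.atTop := by
          refine Filter.liminf_le_liminf (Filter.Eventually.of_forall fun k ↦ ?_)
          rw [← ofReal_integral_eq_lintegral_ofReal (hu k)
            (Filter.Eventually.of_forall fun x ↦ sq_nonneg _)]
          exact ENNReal.ofReal_le_ofReal (hua k)
      _ = ENNReal.ofReal A := (ENNReal.tendsto_ofReal ha).liminf_eq
  have hi : Integrable (fun x ↦ v x ^ 2) μ := by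
    refine ⟨hv.pow 2, ?_⟩
    rw [hasFiniteIntegral_iff_ofReal (Filter.Eventually.of_forall fun x ↦ sq_nonneg _)]
    exact key.trans_lt ENNReal.ofReal_lt_top
  refine ⟨hi, ?_⟩
  rw [← ofReal_integral_eq_lintegral_ofReal hi
    (Filter.Eventually.of_forall fun x ↦ sq_nonneg _)] at key
  exact (ENNReal.ofReal_le_ofReal_iff hA).mp key

section Smoothing

/-- Functions decreasing to the indicator of the sublevel set `{φ ≤ 0}`, smooth when `φ` is. -/
def smoothIndicator {X : Type*} (φ : X → ℝ) (k : ℕ) (x : X) : ℝ :=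
  Real.smoothTransition (1 - (k + 1) * φ x)

lemma smoothIndicator_eq_one {X : Type*} {φ : X → ℝ} (k : ℕ) {x : X} (hx : φ x ≤ 0) :
    smoothIndicator φ k x = 1 := by
  refine Real.smoothTransition.one_of_one_le ?_
  have : ((k : ℝ) + 1) * φ x ≤ 0 := mul_nonpos_of_nonneg_of_nonpos (by positivity) hx
  linarith

lemma smoothIndicator_eq_zero {X : Type*} {φ : X → ℝ} (k : ℕ) {x : X} (hx : 1 ≤ φ x) :
    smoothIndicator φ k x = 0 := by
  refine Real.smoothTransition.zero_of_nonpos ?_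
  nlinarith [(k.cast_nonneg : (0 : ℝ) ≤ k)]

lemma tendsto_smoothIndicator {X : Type*} {φ : X → ℝ} {S : Set X}
    (hS : ∀ x, x ∈ S ↔ φ x ≤ 0) (x : X) :
    Filter.Tendsto (fun k ↦ smoothIndicator φ k x) Filter.atTop
      (nhds (S.indicator (fun _ ↦ (1 : ℝ)) x)) := by
  by_cases hx : x ∈ S
  · rw [indicator_of_mem hx]
    simp only [smoothIndicator_eq_one _ ((hS x).mp hx), tendsto_const_nhds]
  · rw [indicator_of_notMem hx]
    have h0 : 0 < φ x := by
      by_contra! h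
      exact hx ((hS x).mpr h)
    obtain ⟨K, hK⟩ := exists_nat_gt (1 / φ x)
    refine tendsto_const_nhds.congr' ?_
    filter_upwards [Filter.eventually_ge_atTop K] with k hk
    refine (Real.smoothTransition.zero_of_nonpos ?_).symm
    have h1 : (K : ℝ) ≤ k := by exact_mod_cast hk
    rw [div_lt_iff₀ h0] at hK
    nlinarith

lemma integrable_indicator_one {X : Type*} [MeasurableSpace X] [TopologicalSpace X] [T2Space X]
    [OpensMeasurableSpace X] {μ : Measure X} [IsFiniteMeasureOnCompacts μ] {S : Set X}
    (hS : IsCompact S) : Integrable (S.indicator (fun _ ↦ (1 : ℝ))) μ :=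
  (integrable_indicator_iff hS.measurableSet).mpr (integrableOn_const hS.measure_lt_top.ne)

variable {V : Type*} [NormedAddCommGroup V] [InnerProductSpace ℝ V] {φ : V → ℝ} {S : Set V} {R : ℝ}

lemma contDiff_smoothIndicator (hφ : ContDiff ℝ (⊤ : ℕ∞) φ) (k : ℕ) :
    ContDiff ℝ (⊤ : ℕ∞) (smoothIndicator φ k) :=
  Real.smoothTransition.contDiff.comp (contDiff_const.sub (contDiff_const.mul hφ))

lemma norm_smoothIndicator_le {W : Type*} [SeminormedAddCommGroup W] {φ : W → ℝ} {R : ℝ}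
    (hR : ∀ x, φ x < 1 → ‖x‖ ≤ R) (k : ℕ) (x : W) :
    ‖smoothIndicator φ k x‖ ≤ (Metric.closedBall (0 : W) R).indicator (fun _ ↦ (1 : ℝ)) x := by
  by_cases hx : x ∈ Metric.closedBall (0 : W) R
  · rw [indicator_of_mem hx, smoothIndicator, Real.norm_of_nonneg (Real.smoothTransition.nonneg _)]
    exact Real.smoothTransition.le_one _
  · rw [indicator_of_notMem hx, smoothIndicator_eq_zero, norm_zero]
    by_contra! h
    exact hx (by simpa using hR x h)

variable [FiniteDimensional ℝ V]

lemma hasCompactSupport_smoothIndicator (hR : ∀ x, φ x < 1 → ‖x‖ ≤ R) (k : ℕ) :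
    HasCompactSupport (smoothIndicator φ k) := by
  refine HasCompactSupport.intro (isCompact_closedBall (0 : V) R) fun x hx ↦ ?_
  have := norm_smoothIndicator_le hR k x
  rwa [indicator_of_notMem hx, norm_le_zero_iff] at this

variable [MeasurableSpace V] [BorelSpace V]

lemma tendsto_integral_smoothIndicator_sq (hφ : ContDiff ℝ (⊤ : ℕ∞) φ)
    (hS : ∀ x, x ∈ S ↔ φ x ≤ 0) (hSm : MeasurableSet S) (hR : ∀ x, φ x < 1 → ‖x‖ ≤ R) :
    Filter.Tendsto (fun k ↦ ∫ x, smoothIndicator φ k x ^ 2) Filter.atTop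
      (nhds (volume.real S)) := by
  have h : ∫ x, S.indicator (fun _ ↦ (1 : ℝ)) x ^ 2 = volume.real S := by
    rw [← integral_indicator_one hSm]
    refine integral_congr_ae (Filter.Eventually.of_forall fun x ↦ ?_)
    by_cases hx : x ∈ S <;> simp [hx]
  rw [← h]
  refine tendsto_integral_of_dominated_convergence
    ((Metric.closedBall (0 : V) R).indicator (fun _ ↦ (1 : ℝ))) (fun k ↦ ?_)
    (integrable_indicator_one (isCompact_closedBall _ _)) (fun k ↦ ?_) ?_
  · exact ((contDiff_smoothIndicator hφ k).continuous.pow 2).aestronglyMeasurable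
  · refine Filter.Eventually.of_forall fun x ↦ le_trans ?_ (norm_smoothIndicator_le hR k x)
    have h0 := Real.smoothTransition.nonneg (1 - (k + 1) * φ x)
    have h1 := Real.smoothTransition.le_one (1 - (k + 1) * φ x)
    rw [Real.norm_of_nonneg (sq_nonneg _), smoothIndicator, Real.norm_of_nonneg h0]
    nlinarith
  · exact Filter.Eventually.of_forall fun x ↦ (tendsto_smoothIndicator hS x).pow 2

lemma tendsto_cosTransform_smoothIndicator (hφ : ContDiff ℝ (⊤ : ℕ∞) φ)
    (hS : ∀ x, x ∈ S ↔ φ x ≤ 0) (hR : ∀ x, φ x < 1 → ‖x‖ ≤ R) (ξ : V) :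
    Filter.Tendsto (fun k ↦ cosTransform (smoothIndicator φ k) ξ) Filter.atTop
      (nhds (cosTransform (S.indicator fun _ ↦ 1) ξ)) :=
  tendsto_cosTransform
    (fun k ↦ (contDiff_smoothIndicator hφ k).continuous.aestronglyMeasurable)
    (integrable_indicator_one (isCompact_closedBall _ _)) (norm_smoothIndicator_le hR)
    (tendsto_smoothIndicator hS) ξ

lemma integral_cosTransform_indicator_sq_le (hS : IsCompact S) :
    Integrable (fun ξ ↦ cosTransform (S.indicator fun _ ↦ 1) ξ ^ 2) ∧
      ∫ ξ, cosTransform (S.indicator fun _ ↦ 1) ξ ^ 2 ≤ volume.real S := by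
  obtain ⟨R, hR⟩ := hS.isBounded.subset_ball (0 : V)
  obtain ⟨f, hf, hf0, hfs, hf1⟩ := exists_contMDiff_support_eq_eq_one_iff
    (modelWithCornersSelf ℝ V) (Metric.isOpen_ball (x := (0 : V)) (ε := R)) hS.isClosed hR
  have hφ : ContDiff ℝ (⊤ : ℕ∞) fun x ↦ 1 - f x :=
    contDiff_const.sub (contMDiff_iff_contDiff.mp hf)
  have hφS : ∀ x, x ∈ S ↔ 1 - f x ≤ 0 := fun x ↦ by
    have := (hf0 (mem_range_self x)).2
    rw [hf1]
    constructor <;> intro h <;> linarith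
  have hφR : ∀ x, 1 - f x < 1 → ‖x‖ ≤ R := fun x hx ↦ by
    have : x ∈ Function.support f := Function.mem_support.mpr (by linarith)
    rw [hfs] at this
    exact (mem_ball_zero_iff.mp this).le
  have h1 := fun k ↦ integral_cosTransform_sq_le (hasCompactSupport_smoothIndicator hφR k)
    (contDiff_smoothIndicator hφ k)
  exact integral_sq_le_of_tendsto
    (continuous_cosTransform (integrable_indicator_one hS)).aestronglyMeasurable
    (fun k ↦ (h1 k).1) (fun k ↦ (h1 k).2)
    (tendsto_integral_smoothIndicator_sq hφ hφS hS.measurableSet hφR)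
    (tendsto_cosTransform_smoothIndicator hφ hφS hφR)

end Smoothing

section Identity

variable {m : ℕ}

lemma cosTransform_indicator_eq {B : Set (EuclideanSpace ℝ (Fin (m + 1)))} (hB : IsCompact B)
    {N : EuclideanSpace ℝ (Fin (m + 1)) → ℝ} (hN : Continuous N)
    (hN1 : ∀ t : ℝ, 0 < t → ∀ x, N (t • x) = t * N x) (hN2 : ∀ x, x ≠ 0 → 0 < N x)
    (hx : ∀ x ∈ B, ∀ ξ, |inner ℝ ξ x| ≤ N ξ)
    (hv : volume.real B * volume.real {ξ | N ξ ≤ 1}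
      = volume.real (Metric.closedBall (0 : EuclideanSpace ℝ (Fin (m + 1))) 1) ^ 2)
    (ξ : EuclideanSpace ℝ (Fin (m + 1))) :
    cosTransform (B.indicator fun _ ↦ 1) ξ
      = volume.real B / volume.real (Metric.closedBall (0 : EuclideanSpace ℝ (Fin (m + 1))) 1)
        * cosTransform ((Metric.closedBall (0 : EuclideanSpace ℝ (Fin (m + 1))) 1).indicator
          fun _ ↦ 1) (N ξ • EuclideanSpace.single 0 1) := by
  set e : EuclideanSpace ℝ (Fin (m + 1)) := EuclideanSpace.single 0 1 with he
  have hen : ‖e‖ = 1 := by simp [he]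
  set D := Metric.closedBall (0 : EuclideanSpace ℝ (Fin (m + 1))) 1 with hD
  have hd0 : 0 < volume.real D :=
    ENNReal.toReal_pos (Metric.measure_closedBall_pos _ _ one_pos).ne' measure_closedBall_lt_top.ne
  set b := volume.real B with hb
  set d := volume.real D with hd
  set q := volume.real {ξ | N ξ ≤ 1} with hq
  set φ : EuclideanSpace ℝ (Fin (m + 1)) → ℝ := fun x ↦ ‖x‖ ^ 2 - 1 with hφdef
  have hφ : ContDiff ℝ (⊤ : ℕ∞) φ := (contDiff_norm_sq ℝ).sub contDiff_const
  have hφD : ∀ x, x ∈ D ↔ φ x ≤ 0 := fun x ↦ by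
    rw [hD, mem_closedBall_zero_iff, hφdef, sub_nonpos, sq_le_one_iff₀ (norm_nonneg x)]
  have hφR : ∀ x, φ x < 1 → ‖x‖ ≤ 2 := fun x h ↦ by
    simp only [hφdef] at h
    nlinarith [norm_nonneg x]
  set θ := smoothIndicator φ with hθ
  have hθc := hasCompactSupport_smoothIndicator hφR
  have hθs := contDiff_smoothIndicator hφ
  have hθi : ∀ k, Integrable (θ k) := fun k ↦
    (hθs k).continuous.integrable_of_hasCompactSupport (hθc k)
  have hθr : ∀ k x y, ‖x‖ = ‖y‖ → θ k x = θ k y := fun k x y h ↦ by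
    simp only [hθ, smoothIndicator, hφdef, h]
  set T : ℕ → ℝ → ℝ := fun k t ↦ cosTransform (θ k) (t • e) with hT
  have hTc : ∀ k, Continuous (T k) := fun k ↦
    (continuous_cosTransform (hθi k)).comp (continuous_id.smul continuous_const)
  have hTn : ∀ k, (fun ξ ↦ T k ‖ξ‖) = cosTransform (θ k) := fun k ↦ funext fun ξ ↦
    cosTransform_eq_of_norm_eq (hθr k) (by rw [norm_smul, norm_norm, hen, mul_one])
  have hTi : ∀ k, Integrable fun ξ : EuclideanSpace ℝ (Fin (m + 1)) ↦ T k ‖ξ‖ := fun k ↦ by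
    rw [hTn]
    exact integrable_cosTransform (hθc k) (hθs k)
  have hTT : ∀ k x, cosTransform (fun ξ : EuclideanSpace ℝ (Fin (m + 1)) ↦ T k ‖ξ‖) x = θ k x :=
    fun k x ↦ by
      rw [hTn]
      exact cosTransform_cosTransform (hθc k) (hθs k) (fun x ↦ hθr k _ _ (norm_neg x)) x
  have hT1 : ∀ k x, ‖x‖ ≤ 1 →
      cosTransform (fun ξ : EuclideanSpace ℝ (Fin (m + 1)) ↦ T k ‖ξ‖) x = 1 := fun k x h ↦ by
    rw [hTT]
    exact smoothIndicator_eq_one k ((hφD x).mp (mem_closedBall_zero_iff.mpr h))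
  have hTint : ∀ k, ∫ ξ : EuclideanSpace ℝ (Fin (m + 1)), T k ‖ξ‖ = 1 := fun k ↦ by
    rw [← hT1 k 0 (by simp)]
    simp [cosTransform]
  have hPi : ∀ k, Integrable fun ξ ↦ T k (N ξ) := fun k ↦
    integrable_comp_of_integrable_comp_norm hN hN1 hN2 (hTc k) (hTi k)
  have hsq : ∀ k, Integrable (fun ξ ↦ T k (N ξ) ^ 2) ∧
      ∫ ξ, T k (N ξ) ^ 2 ≤ q / d * ∫ x, θ k x ^ 2 := fun k ↦ by
    have h1 := integral_cosTransform_sq_le (hθc k) (hθs k)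
    rw [← hTn k] at h1
    refine ⟨integrable_comp_of_integrable_comp_norm hN hN1 hN2 (g := fun t ↦ T k t ^ 2)
      ((hTc k).pow 2) h1.1, ?_⟩
    rw [integral_comp_eq_integral_comp_norm (g := fun t ↦ T k t ^ 2) hN hN1 hN2 ((hTc k).pow 2)]
    exact mul_le_mul_of_nonneg_left h1.2 (by positivity)
  have hBi := integrable_indicator_one (μ := volume) hB
  set F := cosTransform (B.indicator fun _ ↦ (1 : ℝ)) with hF
  have hFc : Continuous F := continuous_cosTransform hBi
  obtain ⟨hFi, hF2⟩ := integral_cosTransform_indicator_sq_le hB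
  have hcross : ∀ k, ∫ ξ, F ξ * T k (N ξ) = b * (q / d) := fun k ↦ by
    rw [hF, integral_cosTransform_mul hBi (hPi k), hb, ← integral_indicator_one hB.measurableSet,
      ← integral_mul_const]
    refine integral_congr_ae (Filter.Eventually.of_forall fun x ↦ ?_)
    by_cases hxB : x ∈ B
    · simp only [indicator_of_mem hxB, Pi.one_apply, one_mul]
      rw [cosTransform_comp_eq_integral (hTc k) (hTi k) (hT1 k) hN hN1 hN2 (hx x hxB),
        integral_comp_eq_integral_comp_norm hN hN1 hN2 (hTc k), hTint, mul_one]
    · simp [indicator_of_notMem hxB]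
  have hcross_i : ∀ k, Integrable fun ξ ↦ F ξ * T k (N ξ) := fun k ↦ by
    refine (hPi k).bdd_mul (c := ∫ x, ‖B.indicator (fun _ ↦ (1 : ℝ)) x‖)
      hFc.aestronglyMeasurable (Filter.Eventually.of_forall fun ξ ↦ ?_)
    exact norm_integral_le_of_norm_le hBi.norm
      (Filter.Eventually.of_forall fun x ↦ norm_cos_mul_le _ _)
  set G : EuclideanSpace ℝ (Fin (m + 1)) → ℝ := fun ξ ↦
    F ξ - b / d * cosTransform (D.indicator fun _ ↦ 1) (N ξ • e) with hG
  have hGc : Continuous G := hFc.sub (continuous_const.mul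
    ((continuous_cosTransform (integrable_indicator_one (isCompact_closedBall _ _))).comp
      (hN.smul continuous_const)))
  have hexp : ∀ k, (fun ξ ↦ (F ξ - b / d * T k (N ξ)) ^ 2) = fun ξ ↦
      F ξ ^ 2 - 2 * (b / d) * (F ξ * T k (N ξ)) + (b / d) ^ 2 * T k (N ξ) ^ 2 := fun k ↦
    funext fun ξ ↦ by ring
  have hGz : Integrable (fun ξ ↦ G ξ ^ 2) ∧ ∫ ξ, G ξ ^ 2
      ≤ b - 2 * (b / d) * (b * (q / d)) + (b / d) ^ 2 * (q / d * d) := by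
    refine integral_sq_le_of_tendsto (u := fun k ξ ↦ F ξ - b / d * T k (N ξ))
      (a := fun k ↦ b - 2 * (b / d) * (b * (q / d)) + (b / d) ^ 2 * (q / d * ∫ x, θ k x ^ 2))
      hGc.aestronglyMeasurable (fun k ↦ ?_) (fun k ↦ ?_) ?_ ?_
    · rw [hexp]
      exact (hFi.sub ((hcross_i k).const_mul _)).add ((hsq k).1.const_mul _)
    · have h1 := (hcross_i k).const_mul (2 * (b / d))
      have h2 : ∫ ξ, F ξ ^ 2 - 2 * (b / d) * (F ξ * T k (N ξ)) + (b / d) ^ 2 * T k (N ξ) ^ 2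
          = (∫ ξ, F ξ ^ 2 - 2 * (b / d) * (F ξ * T k (N ξ)))
            + ∫ ξ, (b / d) ^ 2 * T k (N ξ) ^ 2 :=
        integral_add (hFi.sub h1) ((hsq k).1.const_mul _)
      have h3 : ∫ ξ, F ξ ^ 2 - 2 * (b / d) * (F ξ * T k (N ξ))
          = (∫ ξ, F ξ ^ 2) - ∫ ξ, 2 * (b / d) * (F ξ * T k (N ξ)) := integral_sub hFi h1
      rw [hexp, h2, h3, integral_const_mul, integral_const_mul, hcross]
      have := mul_le_mul_of_nonneg_left (hsq k).2 (sq_nonneg (b / d))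
      linarith
    · refine Filter.Tendsto.const_add _ (Filter.Tendsto.const_mul _ (Filter.Tendsto.const_mul _ ?_))
      exact tendsto_integral_smoothIndicator_sq hφ hφD measurableSet_closedBall hφR
    · exact fun ξ ↦ ((tendsto_cosTransform_smoothIndicator hφ hφD hφR (N ξ • e)).const_mul
        _).const_sub _
  have hzero : b - 2 * (b / d) * (b * (q / d)) + (b / d) ^ 2 * (q / d * d) = 0 := by
    have : b * b * q = b * d ^ 2 := by rw [← hv]; ring
    field_simp
    linear_combination -this
  have hG0 : ∫ ξ, G ξ ^ 2 = 0 :=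
    le_antisymm (hzero ▸ hGz.2) (integral_nonneg fun ξ ↦ sq_nonneg _)
  rw [integral_eq_zero_iff_of_nonneg (fun ξ ↦ sq_nonneg _) hGz.1] at hG0
  have := congrFun ((Continuous.ae_eq_iff_eq volume (hGc.pow 2) continuous_zero).mp hG0) ξ
  exact sub_eq_zero.mp (pow_eq_zero_iff two_ne_zero |>.mp this)

end Identity

section SecondMoment

variable {V : Type*} [NormedAddCommGroup V] [InnerProductSpace ℝ V] [FiniteDimensional ℝ V]
  [MeasurableSpace V] [BorelSpace V] {S : Set V}

lemma integrableOn_inner_sq (hS : IsCompact S) (ξ : V) :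
    IntegrableOn (fun x ↦ inner ℝ x ξ ^ 2) S :=
  ContinuousOn.integrableOn_compact hS (Continuous.continuousOn (by fun_prop))

lemma integrableOn_inner_mul_inner (hS : IsCompact S) (ξ η : V) :
    IntegrableOn (fun x ↦ inner ℝ x ξ * inner ℝ x η) S :=
  ContinuousOn.integrableOn_compact hS (Continuous.continuousOn (by fun_prop))

lemma setIntegral_inner_sq_pos (hS : IsCompact S) (h0 : 0 ∈ interior S) {ξ : V} (hξ : ξ ≠ 0) :
    0 < ∫ x in S, inner ℝ x ξ ^ 2 := by
  rw [setIntegral_pos_iff_support_of_nonneg_ae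
    (Filter.Eventually.of_forall fun x ↦ sq_nonneg _) (integrableOn_inner_sq hS ξ)]
  have ho : IsOpen ((Function.support fun x : V ↦ inner ℝ x ξ ^ 2) ∩ interior S) :=
    (Continuous.isOpen_support (by fun_prop)).inter isOpen_interior
  have ht : Filter.Tendsto (fun t : ℝ ↦ t • ξ) (nhdsWithin 0 (Ioi 0)) (nhds 0) := by
    have : Filter.Tendsto (fun t : ℝ ↦ t • ξ) (nhds 0) (nhds ((0 : ℝ) • ξ)) :=
      Continuous.tendsto (by fun_prop) 0
    rw [zero_smul] at this
    exact this.mono_left nhdsWithin_le_nhds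
  obtain ⟨t, ht1, ht2⟩ := ((ht.eventually (isOpen_interior.mem_nhds h0)).and
    self_mem_nhdsWithin).exists
  refine (ho.measure_pos volume ⟨t • ξ, ?_, ht1⟩).trans_le
    (measure_mono (inter_subset_inter_right _ interior_subset))
  rw [Function.mem_support, real_inner_smul_left, real_inner_self_eq_norm_sq]
  have : 0 < t := ht2
  have : 0 < ‖ξ‖ := norm_pos_iff.mpr hξ
  positivity

lemma tendsto_mul_one_sub_cos (a : ℝ) :
    Filter.Tendsto (fun k : ℕ ↦ ((k : ℝ) + 1) ^ 2 * (1 - Real.cos (a * (1 / ((k : ℝ) + 1)))))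
      Filter.atTop (nhds (a ^ 2 / 2)) := by
  have hd : HasDerivAt (fun t : ℝ ↦ Real.sin (a / 2 * t)) (a / 2) 0 := by
    have := ((hasDerivAt_id (0 : ℝ)).const_mul (a / 2)).sin
    simpa using this
  have h1 := hd.tendsto_slope_zero
  have h2 : Filter.Tendsto (fun k : ℕ ↦ 1 / ((k : ℝ) + 1)) Filter.atTop (nhdsWithin 0 {0}ᶜ) := by
    refine tendsto_nhdsWithin_iff.mpr ⟨tendsto_one_div_add_atTop_nhds_zero_nat, ?_⟩
    exact Filter.Eventually.of_forall fun k ↦ (Nat.one_div_pos_of_nat).ne'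
  have h3 := ((h1.comp h2).pow 2).const_mul 2
  rw [show 2 * (a / 2) ^ 2 = a ^ 2 / 2 by ring] at h3
  refine h3.congr fun k ↦ ?_
  simp only [Function.comp_apply, zero_add, mul_zero, Real.sin_zero, sub_zero, smul_eq_mul,
    one_div, inv_inv]
  rw [mul_pow, Real.sin_sq_eq_half_sub]
  rw [show 2 * (a / 2 * ((k : ℝ) + 1)⁻¹) = a * ((k : ℝ) + 1)⁻¹ by ring]
  ring

lemma tendsto_sub_cosTransform_indicator (hS : IsCompact S) (ξ : V) :
    Filter.Tendsto (fun k : ℕ ↦ ((k : ℝ) + 1) ^ 2 *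
        (volume.real S - cosTransform (S.indicator fun _ ↦ 1) ((1 / ((k : ℝ) + 1)) • ξ)))
      Filter.atTop (nhds (2 * Real.pi ^ 2 * ∫ x in S, inner ℝ x ξ ^ 2)) := by
  have heq : ∀ k : ℕ, ((k : ℝ) + 1) ^ 2 *
        (volume.real S - cosTransform (S.indicator fun _ ↦ 1) ((1 / ((k : ℝ) + 1)) • ξ))
      = ∫ x in S, ((k : ℝ) + 1) ^ 2 *
        (1 - Real.cos (2 * Real.pi * inner ℝ x ξ * (1 / ((k : ℝ) + 1)))) := by
    intro k
    have h1 : cosTransform (S.indicator fun _ ↦ (1 : ℝ)) ((1 / ((k : ℝ) + 1)) • ξ)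
        = ∫ x in S, Real.cos (2 * Real.pi * inner ℝ x ξ * (1 / ((k : ℝ) + 1))) := by
      rw [cosTransform, ← integral_indicator hS.measurableSet]
      refine integral_congr_ae (Filter.Eventually.of_forall fun x ↦ ?_)
      by_cases hx : x ∈ S
      · simp only [indicator_of_mem hx, mul_one, real_inner_smul_right]
        congr 1
        ring
      · simp [indicator_of_notMem hx]
    have h2 : volume.real S = ∫ x in S, (1 : ℝ) := by simp
    have h3 : IntegrableOn (fun _ ↦ (1 : ℝ)) S := integrableOn_const hS.measure_lt_top.ne
    have h4 : IntegrableOn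
        (fun x ↦ Real.cos (2 * Real.pi * inner ℝ x ξ * (1 / ((k : ℝ) + 1)))) S :=
      ContinuousOn.integrableOn_compact hS (Continuous.continuousOn (by fun_prop))
    rw [integral_const_mul, integral_sub h3 h4, ← h2, h1]
  simp only [heq]
  rw [← integral_const_mul]
  refine tendsto_integral_of_dominated_convergence
    (fun x ↦ 2 * Real.pi ^ 2 * inner ℝ x ξ ^ 2) (fun k ↦ ?_)
    ((integrableOn_inner_sq hS ξ).const_mul _) (fun k ↦ ?_) ?_
  · exact Continuous.aestronglyMeasurable (by fun_prop)
  · refine Filter.Eventually.of_forall fun x ↦ ?_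
    have h1 := Real.cos_le_one (2 * Real.pi * inner ℝ x ξ * (1 / ((k : ℝ) + 1)))
    have h2 := Real.one_sub_sq_div_two_le_cos (x := 2 * Real.pi * inner ℝ x ξ * (1 / ((k : ℝ) + 1)))
    rw [Real.norm_of_nonneg (mul_nonneg (sq_nonneg _) (by linarith))]
    calc ((k : ℝ) + 1) ^ 2 * (1 - Real.cos (2 * Real.pi * inner ℝ x ξ * (1 / ((k : ℝ) + 1))))
        ≤ ((k : ℝ) + 1) ^ 2 * ((2 * Real.pi * inner ℝ x ξ * (1 / ((k : ℝ) + 1))) ^ 2 / 2) :=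
          mul_le_mul_of_nonneg_left (by linarith) (sq_nonneg _)
      _ = 2 * Real.pi ^ 2 * inner ℝ x ξ ^ 2 := by
          have : (k : ℝ) + 1 ≠ 0 := by positivity
          field_simp
  · refine Filter.Eventually.of_forall fun x ↦ ?_
    have := tendsto_mul_one_sub_cos (2 * Real.pi * inner ℝ x ξ)
    rwa [show (2 * Real.pi * inner ℝ x ξ) ^ 2 / 2 = 2 * Real.pi ^ 2 * inner ℝ x ξ ^ 2 by ring]
      at this

end SecondMoment

section Ellipsoid

variable {m : ℕ}

lemma setIntegral_inner_sq_eq {B : Set (EuclideanSpace ℝ (Fin (m + 1)))} (hB : IsCompact B)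
    {N : EuclideanSpace ℝ (Fin (m + 1)) → ℝ} (hN : Continuous N)
    (hN1 : ∀ t : ℝ, 0 < t → ∀ x, N (t • x) = t * N x) (hN2 : ∀ x, x ≠ 0 → 0 < N x)
    (hx : ∀ x ∈ B, ∀ ξ, |inner ℝ ξ x| ≤ N ξ)
    (hv : volume.real B * volume.real {ξ | N ξ ≤ 1}
      = volume.real (Metric.closedBall (0 : EuclideanSpace ℝ (Fin (m + 1))) 1) ^ 2)
    (ξ : EuclideanSpace ℝ (Fin (m + 1))) :
    ∫ x in B, inner ℝ x ξ ^ 2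
      = volume.real B / volume.real (Metric.closedBall (0 : EuclideanSpace ℝ (Fin (m + 1))) 1)
        * (∫ x in Metric.closedBall (0 : EuclideanSpace ℝ (Fin (m + 1))) 1,
          inner ℝ x (EuclideanSpace.single 0 1) ^ 2) * N ξ ^ 2 := by
  have hd0 : 0 < volume.real (Metric.closedBall (0 : EuclideanSpace ℝ (Fin (m + 1))) 1) :=
    ENNReal.toReal_pos (Metric.measure_closedBall_pos _ _ one_pos).ne' measure_closedBall_lt_top.ne
  have h1 := tendsto_sub_cosTransform_indicator hB ξ
  have h2 := (tendsto_sub_cosTransform_indicator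
    (isCompact_closedBall (0 : EuclideanSpace ℝ (Fin (m + 1))) 1)
    (N ξ • EuclideanSpace.single 0 1)).const_mul
      (volume.real B / volume.real (Metric.closedBall (0 : EuclideanSpace ℝ (Fin (m + 1))) 1))
  have h3 := tendsto_nhds_unique h1 (h2.congr fun k ↦ ?_)
  · simp only [real_inner_smul_right, mul_pow, integral_const_mul] at h3
    have : (2 * Real.pi ^ 2) ≠ 0 := by positivity
    refine mul_left_cancel₀ this (h3.trans ?_)
    ring
  · rw [cosTransform_indicator_eq hB hN hN1 hN2 hx hv, hN1 _ Nat.one_div_pos_of_nat, mul_smul]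
    field_simp

/-- A positive definite quadratic form on a Euclidean space is the squared norm of a linear
automorphism. -/
lemma exists_linearEquiv_norm_sq_eq {n : ℕ}
    (b : LinearMap.BilinForm ℝ (EuclideanSpace ℝ (Fin n))) (hb : ∀ x, x ≠ 0 → 0 < b x x) :
    ∃ A : EuclideanSpace ℝ (Fin n) ≃ₗ[ℝ] EuclideanSpace ℝ (Fin n), ∀ x, ‖A x‖ ^ 2 = b x x := by
  obtain ⟨w, ⟨e⟩⟩ := QuadraticForm.equivalent_signType_weighted_sum_squared b.toQuadraticMap
  have hw : ∀ i, ((w i : SignType) : ℝ) = 1 := fun i ↦ by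
    have h1 : 0 < ((w i : SignType) : ℝ) := by
      have h2 := hb (e.toLinearEquiv.symm (Pi.single i 1)) (by simp)
      have h3 := e.map_app (e.toLinearEquiv.symm (Pi.single i 1))
      have h4 : e (e.toLinearEquiv.symm (Pi.single i 1)) = Pi.single i 1 :=
        e.toLinearEquiv.apply_symm_apply _
      rw [h4, QuadraticMap.weightedSumSquares_apply, Finset.sum_eq_single i] at h3
      · simp only [Pi.single_eq_same, mul_one, smul_eq_mul] at h3
        rw [h3]
        exact h2
      · intro j _ hj
        simp [hj]
      · simp
    cases h : w i <;> simp [h] at h1 ⊢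
    linarith
  have hf : Module.finrank ℝ (EuclideanSpace ℝ (Fin n)) = n := finrank_euclideanSpace_fin
  refine ⟨e.toLinearEquiv.trans ((LinearEquiv.funCongrLeft ℝ ℝ (finCongr hf.symm)).trans
    (WithLp.linearEquiv 2 ℝ (Fin n → ℝ)).symm), fun x ↦ ?_⟩
  have h := e.map_app x
  rw [QuadraticMap.weightedSumSquares_apply] at h
  simp only [hw, one_smul] at h
  rw [EuclideanSpace.real_norm_sq_eq]
  refine Eq.trans ?_ h
  rw [← (finCongr hf.symm).sum_comp]
  exact Finset.sum_congr rfl fun i _ ↦ sq _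

lemma det_adjoint_eq {n : ℕ} (A : EuclideanSpace ℝ (Fin n) →ₗ[ℝ] EuclideanSpace ℝ (Fin n)) :
    LinearMap.det (LinearMap.adjoint A) = LinearMap.det A := by
  let b := EuclideanSpace.basisFun (Fin n) ℝ
  rw [← LinearMap.det_toMatrix b.toBasis, ← LinearMap.det_toMatrix b.toBasis A,
    LinearMap.toMatrix_adjoint, Matrix.det_conjTranspose, star_trivial]

end Ellipsoid

section Support

variable {V : Type*} [NormedAddCommGroup V] [InnerProductSpace ℝ V] {B : Set V}

/-- The support function of a set. -/
def supportFun (B : Set V) (ξ : V) : ℝ := sSup ((fun x ↦ inner ℝ ξ x) '' B)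

lemma inner_le_supportFun (hB : IsCompact B) {x : V} (hx : x ∈ B) (ξ : V) :
    inner ℝ ξ x ≤ supportFun B ξ :=
  le_csSup (hB.image (f := fun x ↦ inner ℝ ξ x) (by fun_prop)).bddAbove (mem_image_of_mem _ hx)

lemma supportFun_le_iff (hB : IsCompact B) (hne : B.Nonempty) {ξ : V} {a : ℝ} :
    supportFun B ξ ≤ a ↔ ∀ x ∈ B, inner ℝ ξ x ≤ a :=
  (csSup_le_iff (hB.image (f := fun x ↦ inner ℝ ξ x) (by fun_prop)).bddAbove
    (hne.image _)).trans forall_mem_image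

lemma continuous_supportFun (hB : IsCompact B) : Continuous (supportFun B) :=
  hB.continuous_sSup (f := fun ξ x ↦ inner ℝ ξ x) (by fun_prop)

lemma supportFun_smul (hB : IsCompact B) (hne : B.Nonempty) {t : ℝ} (ht : 0 < t) (ξ : V) :
    supportFun B (t • ξ) = t * supportFun B ξ := by
  have key : ∀ s : ℝ, 0 < s → ∀ η : V, supportFun B (s • η) ≤ s * supportFun B η := by
    intro s hs η
    rw [supportFun_le_iff hB hne]
    intro x hx
    rw [real_inner_smul_left]
    exact mul_le_mul_of_nonneg_left (inner_le_supportFun hB hx η) hs.le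
  refine le_antisymm (key t ht ξ) ?_
  have := key t⁻¹ (inv_pos.mpr ht) (t • ξ)
  rwa [smul_smul, inv_mul_cancel₀ ht.ne', one_smul, ← div_eq_inv_mul, le_div_iff₀ ht,
    mul_comm] at this

lemma supportFun_pos (hB : IsCompact B) (h0 : 0 ∈ interior B) {ξ : V} (hξ : ξ ≠ 0) :
    0 < supportFun B ξ := by
  have ht : Filter.Tendsto (fun t : ℝ ↦ t • ξ) (nhdsWithin 0 (Ioi 0)) (nhds 0) := by
    have : Filter.Tendsto (fun t : ℝ ↦ t • ξ) (nhds 0) (nhds ((0 : ℝ) • ξ)) :=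
      Continuous.tendsto (by fun_prop) 0
    rw [zero_smul] at this
    exact this.mono_left nhdsWithin_le_nhds
  obtain ⟨t, ht1, ht2⟩ := ((ht.eventually (mem_interior_iff_mem_nhds.mp h0)).and
    self_mem_nhdsWithin).exists
  refine lt_of_lt_of_le ?_ (inner_le_supportFun hB ht1 ξ)
  rw [real_inner_smul_right, real_inner_self_eq_norm_sq]
  have : 0 < t := ht2
  have : 0 < ‖ξ‖ := norm_pos_iff.mpr hξ
  positivity

lemma abs_inner_le_supportFun (hB : IsCompact B) (hs : ∀ x ∈ B, -x ∈ B) {x : V} (hx : x ∈ B)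
    (ξ : V) : |inner ℝ ξ x| ≤ supportFun B ξ := by
  refine abs_le'.mpr ⟨inner_le_supportFun hB hx ξ, ?_⟩
  rw [← inner_neg_right]
  exact inner_le_supportFun hB (hs x hx) ξ

end Support

lemma eq_of_subset_of_measure_le {V : Type*} [NormedAddCommGroup V] [NormedSpace ℝ V]
    [MeasurableSpace V] [BorelSpace V] {μ : Measure V} [μ.IsOpenPosMeasure] {B E : Set V}
    (hB : IsClosed B) (hE : Convex ℝ E) (hi : (interior E).Nonempty) (hBE : B ⊆ E)
    (hfin : μ B ≠ ∞) (h : μ E ≤ μ B) : B = E := by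
  refine hBE.antisymm ?_
  have h1 : μ (interior E \ B) = 0 := by
    refine measure_mono_null (sdiff_subset_sdiff_left interior_subset) ?_
    rw [measure_sdiff hBE hB.measurableSet.nullMeasurableSet hfin, tsub_eq_zero_of_le h]
  have h2 : interior E ⊆ B := by
    rw [← sdiff_eq_empty]
    exact (isOpen_interior.sdiff hB).measure_eq_zero_iff μ |>.mp h1
  calc E ⊆ closure E := subset_closure
    _ = closure (interior E) := (hE.closure_interior_eq_closure_of_nonempty_interior hi).symm
    _ ⊆ B := closure_minimal h2 hB

section Main

variable {m : ℕ}

lemma exists_norm_eq_supportFun {B : Set (EuclideanSpace ℝ (Fin (m + 1)))} (hB : IsCompact B)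
    (hs : ∀ x ∈ B, -x ∈ B) (h0 : 0 ∈ interior B)
    (hv : volume.real B * volume.real {ξ | supportFun B ξ ≤ 1}
      = volume.real (Metric.closedBall (0 : EuclideanSpace ℝ (Fin (m + 1))) 1) ^ 2) :
    ∃ A : EuclideanSpace ℝ (Fin (m + 1)) ≃ₗ[ℝ] EuclideanSpace ℝ (Fin (m + 1)),
      ∀ ξ, ‖A ξ‖ = supportFun B ξ := by
  have hne : B.Nonempty := ⟨0, interior_subset h0⟩
  have hb0 : 0 < volume.real B :=
    ENNReal.toReal_pos (Measure.measure_pos_of_mem_nhds volume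
      (mem_interior_iff_mem_nhds.mp h0)).ne'
      hB.measure_lt_top.ne
  have hd0 : 0 < volume.real (Metric.closedBall (0 : EuclideanSpace ℝ (Fin (m + 1))) 1) :=
    ENNReal.toReal_pos (Metric.measure_closedBall_pos _ _ one_pos).ne' measure_closedBall_lt_top.ne
  have hJ := setIntegral_inner_sq_pos (isCompact_closedBall (0 : EuclideanSpace ℝ (Fin (m + 1))) 1)
    (mem_interior_iff_mem_nhds.mpr (Metric.closedBall_mem_nhds 0 one_pos))
    (ξ := EuclideanSpace.single 0 1) (by simp)
  have hQ := setIntegral_inner_sq_eq hB (continuous_supportFun hB)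
    (fun t ht ↦ supportFun_smul hB hne ht) (fun x hx ↦ supportFun_pos hB h0 hx)
    (fun x hx ↦ abs_inner_le_supportFun hB hs hx) hv
  set κ := volume.real B / volume.real (Metric.closedBall (0 : EuclideanSpace ℝ (Fin (m + 1))) 1)
        * ∫ x in Metric.closedBall (0 : EuclideanSpace ℝ (Fin (m + 1))) 1,
          inner ℝ x (EuclideanSpace.single 0 1) ^ 2
  have hκ : 0 < κ := by positivity
  have hi := integrableOn_inner_mul_inner hB
  set b : LinearMap.BilinForm ℝ (EuclideanSpace ℝ (Fin (m + 1))) :=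
    LinearMap.mk₂ ℝ (fun ξ η ↦ κ⁻¹ * ∫ x in B, inner ℝ x ξ * inner ℝ x η)
      (fun ξ ξ' η ↦ by
        simp only [inner_add_right, add_mul]
        rw [integral_add (hi _ _) (hi _ _), mul_add])
      (fun c ξ η ↦ by
        simp only [real_inner_smul_right, mul_assoc, integral_const_mul, smul_eq_mul]
        ring)
      (fun ξ η η' ↦ by
        simp only [inner_add_right, mul_add]
        rw [integral_add (hi _ _) (hi _ _), mul_add])
      (fun c ξ η ↦ by
        simp only [real_inner_smul_right, mul_left_comm _ c, integral_const_mul, smul_eq_mul])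
  have hb : ∀ ξ, b ξ ξ = supportFun B ξ ^ 2 := fun ξ ↦ by
    simp only [b, LinearMap.mk₂_apply, ← sq, hQ]
    field_simp
  obtain ⟨A, hA⟩ := exists_linearEquiv_norm_sq_eq b fun ξ hξ ↦ by
    rw [hb]
    exact pow_pos (supportFun_pos hB h0 hξ) 2
  refine ⟨A, fun ξ ↦ ?_⟩
  have hN : 0 ≤ supportFun B ξ :=
    (abs_nonneg _).trans (abs_inner_le_supportFun hB hs (interior_subset h0) ξ)
  exact (pow_left_inj₀ (norm_nonneg _) hN two_ne_zero).mp ((hA ξ).trans (hb ξ))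

lemma exists_eq_image_closedBall {B : Set (EuclideanSpace ℝ (Fin (m + 1)))} (hB : IsCompact B)
    (hs : ∀ x ∈ B, -x ∈ B) (h0 : 0 ∈ interior B)
    (hv : volume.real B * volume.real {ξ | ∀ x ∈ B, inner ℝ ξ x ≤ 1}
      = volume.real (Metric.closedBall (0 : EuclideanSpace ℝ (Fin (m + 1))) 1) ^ 2) :
    ∃ A : EuclideanSpace ℝ (Fin (m + 1)) ≃ₗ[ℝ] EuclideanSpace ℝ (Fin (m + 1)),
      B = A '' Metric.closedBall 0 1 := by
  have hne : B.Nonempty := ⟨0, interior_subset h0⟩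
  simp only [← supportFun_le_iff hB hne] at hv
  obtain ⟨A, hA⟩ := exists_norm_eq_supportFun hB hs h0 hv
  have hdet : LinearMap.det A.toLinearMap ≠ 0 :=
    A.isUnit_det'.ne_zero
  have hdet' := det_adjoint_eq A.toLinearMap
  set A' := LinearMap.adjoint A.toLinearMap
  have hd0 : 0 < volume.real (Metric.closedBall (0 : EuclideanSpace ℝ (Fin (m + 1))) 1) :=
    ENNReal.toReal_pos (Metric.measure_closedBall_pos _ _ one_pos).ne' measure_closedBall_lt_top.ne
  have hsub : B ⊆ A' '' Metric.closedBall 0 1 := by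
    intro x hx
    obtain ⟨y, rfl⟩ := (A'.equivOfDetNeZero (hdet' ▸ hdet)).surjective x
    refine ⟨y, ?_, rfl⟩
    rw [mem_closedBall_zero_iff]
    have h1 : ‖y‖ ^ 2 ≤ ‖y‖ := by
      calc ‖y‖ ^ 2 = inner ℝ (A (A.symm y)) y := by
            rw [A.apply_symm_apply, real_inner_self_eq_norm_sq]
        _ = inner ℝ (A.symm y) (A' y) := (LinearMap.adjoint_inner_right _ _ _).symm
        _ ≤ supportFun B (A.symm y) := inner_le_supportFun hB hx _
        _ = ‖y‖ := by rw [← hA, A.apply_symm_apply]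
    by_contra! h
    nlinarith
  refine ⟨A'.equivOfDetNeZero (hdet' ▸ hdet), ?_⟩
  refine eq_of_subset_of_measure_le (μ := volume) hB.isClosed
    ((convex_closedBall _ _).linear_image A') ⟨0, interior_mono hsub h0⟩ hsub
    hB.measure_lt_top.ne ?_
  have hpolar : {ξ | supportFun B ξ ≤ 1} = A.toLinearMap ⁻¹' Metric.closedBall 0 1 := by
    ext ξ
    simp [hA]
  rw [hpolar, measureReal_def (s := _ ⁻¹' _), Measure.addHaar_preimage_linearMap _ hdet,
    ENNReal.toReal_mul, ENNReal.toReal_ofReal (abs_nonneg _), abs_inv, ← measureReal_def] at hv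
  have h1 : volume.real (A' '' Metric.closedBall 0 1) = volume.real B := by
    rw [measureReal_def, Measure.addHaar_image_linearMap, ENNReal.toReal_mul,
      ENNReal.toReal_ofReal (abs_nonneg _), ← measureReal_def, hdet']
    have := abs_pos.mpr hdet
    field_simp at hv
    linarith
  have h2 : volume (A' '' Metric.closedBall 0 1) ≠ ∞ :=
    ((isCompact_closedBall _ _).image A'.continuous_of_finiteDimensional).measure_lt_top.ne
  exact ((measureReal_eq_measureReal_iff h2 hB.measure_lt_top.ne).mp h1).le

end Main

/-- Equality case of the Santaló bound for `p`-balls: if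
`(|B|·|B°|)^(1/n) = (|B_{ℓ₂ⁿ}|²)^(1/n)` then `B` is an ellipsoid; in particular `B`
equals its convex hull. -/
theorem pBall_santalo_equality (n : ℕ) (hn : 0 < n) (p : ℝ) (hp : 0 < p) (hp1 : p ≤ 1)
    (B : Set (Fin n → ℝ)) (hB : IsPBall n p B)
    (heq : sVol n B = ((volume (euclBall n)).toReal ^ 2) ^ ((1 : ℝ) / n)) :
    IsEllipsoid n B ∧ B = convexHull ℝ B := by
  obtain ⟨hBc, hBs, h0, -⟩ := hB
  obtain ⟨m, rfl⟩ := Nat.exists_eq_succ_of_ne_zero hn.ne'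
  set L := EuclideanSpace.equiv (Fin (m + 1)) ℝ
  have hvol : ∀ S : Set (Fin (m + 1) → ℝ), IsClosed S → volume.real (L ⁻¹' S) = volume.real S :=
    fun S hS ↦ (PiLp.volume_preserving_ofLp (Fin (m + 1))).measureReal_preimage
      hS.measurableSet.nullMeasurableSet
  have hball : L ⁻¹' euclBall (m + 1) = Metric.closedBall 0 1 := by
    ext x
    rw [mem_closedBall_zero_iff, ← sq_le_one_iff₀ (norm_nonneg x),
      EuclideanSpace.real_norm_sq_eq]
    rfl
  have hpolar : L ⁻¹' polarSet (m + 1) B = {ξ | ∀ x ∈ L ⁻¹' B, inner ℝ ξ x ≤ 1} := by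
    ext ξ
    refine ⟨fun h x hx ↦ ?_, fun h y hy ↦ ?_⟩
    · rw [real_inner_comm]
      exact h _ hx
    · have := h (L.symm y) (by simpa using hy)
      rwa [real_inner_comm] at this
  have hballc : IsClosed (euclBall (m + 1)) :=
    isClosed_le (by fun_prop) continuous_const
  have hpolarc : IsClosed (polarSet (m + 1) B) := by
    simp only [polarSet, ofPred_forall]
    exact isClosed_biInter fun y _ ↦ isClosed_le (by fun_prop) continuous_const
  have hprod : volume.real B * volume.real (polarSet (m + 1) B)
      = volume.real (euclBall (m + 1)) ^ 2 := by
    refine (Real.rpow_left_inj (by positivity) (by positivity) ?_).mp heq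
    positivity
  obtain ⟨A, hA⟩ := exists_eq_image_closedBall (B := L ⁻¹' B)
    (L.toHomeomorph.isCompact_preimage.mpr hBc)
    (fun x hx ↦ by
      rw [mem_preimage, map_neg, ← Set.mem_neg, ← hBs]
      exact hx)
    (preimage_interior_subset_interior_preimage L.continuous (by simpa using h0))
    (by rw [← hpolar, ← hball, hvol _ hBc.isClosed, hvol _ hpolarc, hvol _ hballc, hprod])
  have hBA : B = (L.toLinearEquiv.symm.trans (A.trans L.toLinearEquiv)) '' euclBall (m + 1) := by
    have h1 : B = L '' (L ⁻¹' B) := (image_preimage_eq B L.surjective).symm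
    have h2 : Metric.closedBall 0 1 = L.symm '' euclBall (m + 1) := by
      rw [← hball, ContinuousLinearEquiv.image_symm_eq_preimage]
    rw [h1, hA, h2, image_image, image_image]
    rfl
  refine ⟨⟨_, hBA⟩, ?_⟩
  have hconv : Convex ℝ (L ⁻¹' B) := hA ▸ (convex_closedBall _ _).linear_image A.toLinearMap
  have hconv' : Convex ℝ B := by
    have := hconv.linear_image L.toLinearEquiv.toLinearMap
    rwa [show L.toLinearEquiv.toLinearMap '' (L ⁻¹' B) = B from
      image_preimage_eq B L.surjective] at this
  exact hconv'.convexHull_eq.symm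
end
end
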